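/- Let μ be an unbounded sequence of positive integers, a ∈ ℂ ∖ 𝔻, and q ≥ 1 an integer; set Q_p(z) = (1 − z/a)^p for 0 ≤ p ≤ q. Then the set 𝒰̃_{Q_q}^μ(𝔻) := ⋃_{p=0}^q 𝒰_{Q_p}^μ(𝔻) is spaceable: there exists a sequence of functions f_k ∈ 𝒰_{Q_q}^μ(𝔻), k ≥ 0, such that F = clos(span(f_k, k ≥ 0)) is a closed infinite-dimensional linear subspace of H(𝔻) and F ∖ {0} ⊂ 𝒰̃_{Q_q}^μ(𝔻). -/

import Mathlib

open Polynomial Filter Finset Metric Topology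

noncomputable section

/-- Coefficient sequence extended to integer indices, with `a k = 0` for `k < 0`. -/
def acoefZ (a : ℕ → ℂ) (k : ℤ) : ℂ := if 0 ≤ k then a k.toNat else 0

/-- The Hankel determinant `C_{m,n} = det (a_{m-n+1+i+j})_{0 ≤ i,j ≤ n-1}`. -/
def hankelDet (a : ℕ → ℂ) (m n : ℕ) : ℂ :=
  Matrix.det (Matrix.of fun i j : Fin n => acoefZ a ((m : ℤ) - n + 1 + i + j))

/-- `IsPade a m n P Q` : the rational function `P/Q` is the Padé approximant of type
`(m,n)` of the formal power series `∑ a_k z^k`. -/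
def IsPade (a : ℕ → ℂ) (m n : ℕ) (P Q : Polynomial ℂ) : Prop :=
  P.natDegree ≤ m ∧ Q.natDegree ≤ n ∧ IsCoprime P Q ∧ Q.coeff 0 = 1 ∧
    ∀ j ≤ m + n, (∑ i ∈ Finset.range (j + 1), Q.coeff i * a (j - i)) = P.coeff j

/-- `𝒟_{m,n}` : the set of coefficient sequences whose Hankel determinant `C_{m,n}`
does not vanish. -/
def Dset (m n : ℕ) : Set (ℕ → ℂ) := {a | hankelDet a m n ≠ 0}

/-- `𝒩_{m,n}` : the subset of `𝒟_{m,n}` of series whose Padé denominator has exact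
degree `n`. -/
def Nset (m n : ℕ) : Set (ℕ → ℂ) :=
  {a | hankelDet a m n ≠ 0 ∧
    ∃ P Q : Polynomial ℂ, IsPade a m n P Q ∧ Q.degree = (n : WithBot ℕ)}

/-- The open unit disc in `ℂ`. -/
def unitD : Set ℂ := Metric.ball (0 : ℂ) 1

/-- The submodule of `ℂ → ℂ` of functions holomorphic on `Ω` (normalized to vanish
outside `Ω`, so that a function is determined by its restriction to `Ω`). -/
def holSubmodule (Ω : Set ℂ) : Submodule ℂ (ℂ → ℂ) where
  carrier := {f | DifferentiableOn ℂ f Ω ∧ ∀ z ∉ Ω, f z = 0}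
  add_mem' := fun hf hg => ⟨hf.1.add hg.1, fun z hz => by simp [hf.2 z hz, hg.2 z hz]⟩
  zero_mem' := ⟨differentiableOn_const 0, fun _ _ => rfl⟩
  smul_mem' := fun c f hf => ⟨hf.1.const_smul c, fun z hz => by simp [hf.2 z hz]⟩

/-- `H(Ω)`, the space of holomorphic functions on `Ω`. -/
abbrev Hol (Ω : Set ℂ) := ↥(holSubmodule Ω)

/-- The topology of uniform convergence on compact subsets of `Ω` on `H(Ω)`. -/
instance holTop (Ω : Set ℂ) : TopologicalSpace (Hol Ω) :=
  TopologicalSpace.induced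
    (fun f : Hol Ω => UniformOnFun.ofFun {K : Set Ω | IsCompact K} fun z : Ω => f.1 z)
    inferInstance

/-- The `k`-th Taylor coefficient at `0` of a function `f`. -/
def tc (f : ℂ → ℂ) (k : ℕ) : ℂ := iteratedDeriv k f 0 / k.factorial

/-- `𝒰_Q^μ(𝔻)` : the set of `f ∈ H(𝔻)` such that for every compact `K` avoiding
`𝔻 ∪ E` with connected complement, and every `h ∈ A(K)`, some subsequence
`(λ_n) = (μ (σ n))` of `μ` satisfies : a) `f ∈ 𝒩_{λ_n,q}`; b) `[f; λ_n/q] → h` in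
`A(K)`; c) `[f; λ_n/q] → f` in `H(𝔻)`; d) the Padé denominator `Q_{λ_n,q}(f)` equals
the prescribed polynomial `Qp`. -/
def UQset (μ : ℕ → ℕ) (q : ℕ) (Qp : Polynomial ℂ) (E : Set ℂ) : Set (Hol unitD) :=
  {f | ∀ K : Set ℂ, IsCompact K → Disjoint K (unitD ∪ E) → IsConnected Kᶜ →
    ∀ h : ℂ → ℂ, ContinuousOn h K → DifferentiableOn ℂ h (interior K) →
    ∃ σ : ℕ → ℕ, StrictMono σ ∧ ∃ P : ℕ → Polynomial ℂ,
      (∀ k, tc f.1 ∈ Nset (μ (σ k)) q ∧ IsPade (tc f.1) (μ (σ k)) q (P k) Qp) ∧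
      TendstoUniformlyOn (fun k z => (P k).eval z / Qp.eval z) h atTop K ∧
      TendstoLocallyUniformlyOn (fun k z => (P k).eval z / Qp.eval z) f.1 atTop unitD}
/-- `𝒰̃_{Q_q}^μ(𝔻) = ⋃_{p=0}^q 𝒰_{Q_p}^μ(𝔻)` where `Q_p(z) = (1 - z/a)^p` (for `p = 0`,
`Q_0 = 1` and the Padé approximants along the `0`-th row are the Taylor partial
sums). -/
def Utilde (μ : ℕ → ℕ) (a : ℂ) (q : ℕ) : Set (Hol unitD) :=
  ⋃ p ∈ Set.Iic q,
    UQset μ p ((1 - Polynomial.C a⁻¹ * Polynomial.X) ^ p)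
      {z : ℂ | ((1 - Polynomial.C a⁻¹ * Polynomial.X) ^ p).eval z = 0}

/-- The uniform closure of the polynomials in `C(K, ℂ)`. -/
def polyClosure (K : Set ℂ) [CompactSpace K] : Subalgebra ℂ C(K, ℂ) :=
  (polynomialFunctions K).topologicalClosure

lemma isClosed_polyClosure (K : Set ℂ) [CompactSpace K] : IsClosed (polyClosure K : Set C(K, ℂ)) :=
  Subalgebra.isClosed_topologicalClosure _

lemma toContinuousMapOn_mem_polyClosure (K : Set ℂ) [CompactSpace K] (p : ℂ[X]) :
    p.toContinuousMapOn K ∈ polyClosure K :=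
  Subalgebra.le_topologicalClosure _ ⟨p, by simp⟩

lemma exists_polynomial_of_mem_polyClosure {K : Set ℂ} [CompactSpace K] {f : C(K, ℂ)}
    (hf : f ∈ polyClosure K) {ε : ℝ} (hε : 0 < ε) :
    ∃ p : ℂ[X], ∀ z : K, ‖f z - p.eval (z : ℂ)‖ < ε := by
  have hf' : f ∈ closure (polynomialFunctions K : Set C(K, ℂ)) := hf
  obtain ⟨g, ⟨p, -, rfl⟩, hg⟩ := Metric.mem_closure_iff.mp hf' ε hε
  refine ⟨p, fun z => ?_⟩
  have := (ContinuousMap.dist_lt_iff hε).mp hg z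
  simpa [dist_eq_norm] using this

lemma exists_inv_mem_polyClosure {K : Set ℂ} [CompactSpace K] (hc : IsPreconnected Kᶜ)
    {q : ℂ} (hq : q ∉ K) : ∃ s ∈ polyClosure K, ∀ z : K, s z * ((z : ℂ) - q) = 1 := by
  have : IsClosed (polyClosure K : Set C(K, ℂ)) := isClosed_polyClosure K
  let x : polyClosure K := ⟨_, toContinuousMapOn_mem_polyClosure K X⟩
  have hx : spectrum ℂ (x : C(K, ℂ)) = K := by
    rw [ContinuousMap.spectrum_eq_range]
    ext z
    simp [x]
  have h := Subalgebra.spectrum_eq_of_isPreconnected_compl (𝕜 := ℂ) (polyClosure K) x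
    (by rw [hx]; exact hc)
  rw [hx] at h
  have hq' : q ∉ spectrum ℂ x := by rwa [h]
  rw [spectrum.notMem_iff] at hq'
  obtain ⟨u, hu⟩ := hq'
  refine ⟨-((u⁻¹ : (polyClosure K)ˣ) : polyClosure K), neg_mem (Subtype.property _), fun z => ?_⟩
  have h1 : ((u⁻¹ : (polyClosure K)ˣ) : polyClosure K) * (algebraMap ℂ _ q - x) = 1 := by
    rw [← hu]; simp
  have h2 := congrArg (fun y : polyClosure K => (y : C(K, ℂ)) z) h1
  simp [x] at h2
  rw [ContinuousMap.neg_apply, ← h2]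
  ring_nf

lemma exists_sqrt_mem_polyClosure {K : Set ℂ} [CompactSpace K] {u : C(K, ℂ)}
    (hu : u ∈ polyClosure K) (hb : ∀ z, ‖u z‖ ≤ 1 / 2) :
    ∃ s ∈ polyClosure K, ∀ z, s z ^ 2 = 1 + u z ∧ 0 < (s z).re := by
  have hslit : ∀ w : ℂ, ‖w‖ < 1 → 1 + w ∈ Complex.slitPlane := fun w hw => by
    left
    have := (abs_le.mp (Complex.abs_re_le_norm w)).1
    simp; linarith
  let r : ℂ → ℂ := fun w => (1 + w) ^ (1 / 2 : ℂ)
  have hr : DifferentiableOn ℂ r (closedBall 0 ((3 / 4 : NNReal) : ℝ)) := by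
    intro w hw
    have hw' : ‖w‖ < 1 := by
      rw [mem_closedBall_zero_iff] at hw
      refine hw.trans_lt ?_
      norm_num
    exact ((differentiableAt_id.const_add (1 : ℂ)).cpow_const
      (hslit w hw')).differentiableWithinAt
  have hps := hr.hasFPowerSeriesOnBall (by norm_num)
  have hT := hps.tendstoUniformlyOn (r' := 5 / 8) (by
    rw [ENNReal.coe_lt_coe]
    rw [← NNReal.coe_lt_coe]; norm_num)
  have hcont : Continuous fun z : K => r (u z) := by
    refine continuous_iff_continuousAt.mpr fun z => ?_
    have : ContinuousAt r (u z) :=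
      (((differentiableAt_id.const_add (1 : ℂ)).cpow_const
      (hslit (u z) (by linarith [hb z])))).continuousAt
    exact ContinuousAt.comp (f := u) this u.continuous.continuousAt
  let s : C(K, ℂ) := ⟨_, hcont⟩
  refine ⟨s, ?_, fun z => ⟨?_, ?_⟩⟩
  · refine (isClosed_polyClosure K).mem_of_tendsto (b := atTop)
      (f := fun n => ∑ i ∈ Finset.range n,
        ((cauchyPowerSeries r 0 ((3 / 4 : NNReal) : ℝ)).coeff i) • u ^ i) ?_
      (Eventually.of_forall fun n => ?_)
    · rw [ContinuousMap.tendsto_iff_tendstoUniformly, Metric.tendstoUniformly_iff]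
      intro ε hε
      filter_upwards [Metric.tendstoUniformlyOn_iff.mp hT ε hε] with n hn z
      have := hn (u z) (by
        rw [mem_ball_zero_iff]
        refine (hb z).trans_lt ?_
        norm_num)
      simpa [s, FormalMultilinearSeries.partialSum, mul_comm] using this
    · exact sum_mem fun i _ => Subalgebra.smul_mem _ (pow_mem hu i) _
  · change r (u z) ^ 2 = _
    simp only [r]
    rw [← Complex.cpow_nat_mul]
    norm_num
  · change 0 < (r (u z)).re
    have h1 := hslit (u z) (by linarith [hb z])
    simp only [r]
    rw [Complex.cpow_def_of_ne_zero (Complex.slitPlane_ne_zero h1), Complex.exp_re]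
    refine mul_pos (Real.exp_pos _) (Real.cos_pos_of_mem_Ioo ?_)
    have him : (Complex.log (1 + u z) * (1 / 2)).im = (1 + u z).arg / 2 := by
      rw [show (1 / 2 : ℂ) = ((1 / 2 : ℝ) : ℂ) by norm_num, Complex.im_mul_ofReal, Complex.log_im]
      ring
    rw [him]
    have h2 := Complex.mem_slitPlane_iff_arg.mp h1
    have h3 := Complex.neg_pi_lt_arg (1 + u z)
    have h4 := lt_of_le_of_ne (Complex.arg_le_pi (1 + u z)) h2.1
    constructor <;> linarith

lemma exists_preconnected_to_sphere {K : Set ℂ} (hK : IsCompact K) (hc : IsConnected Kᶜ)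
    {p : ℂ} (hp : p ∉ K) :
    ∃ G : Set ℂ, IsPreconnected G ∧ G ⊆ Kᶜ ∩ closedBall p 1 ∧ p ∈ G ∧ ∃ b ∈ G, ‖p - b‖ = 1 := by
  obtain ⟨R, hR⟩ := hK.isBounded.subset_closedBall (0 : ℂ)
  obtain ⟨x, hx⟩ : ∃ x : ℂ, R < ‖x‖ ∧ 1 ≤ ‖x - p‖ := by
    refine ⟨((|R| + ‖p‖ + 1 : ℝ) : ℂ), ?_, ?_⟩
    · rw [Complex.norm_real, Real.norm_of_nonneg (by positivity)]
      linarith [le_abs_self R, norm_nonneg p]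
    · have h := norm_sub_norm_le ((|R| + ‖p‖ + 1 : ℝ) : ℂ) p
      rw [Complex.norm_real, Real.norm_of_nonneg (by positivity)] at h
      linarith [abs_nonneg R]
  have hxK : x ∈ Kᶜ := fun h => by
    have := hR h
    rw [mem_closedBall_zero_iff] at this
    linarith [hx.1]
  have hpath := (hK.isClosed.isOpen_compl.isConnected_iff_isPathConnected).mp hc
  obtain ⟨γ, hγ⟩ := hpath.joinedIn p hp x hxK
  let φ : ℝ → ℝ := fun t => ‖γ.extend t - p‖
  have hφ : Continuous φ := (γ.continuous_extend.sub continuous_const).norm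
  have hφ0 : φ 0 = 0 := by simp [φ]
  have hφ1 : 1 ≤ φ 1 := by simpa [φ] using hx.2
  have hne : (Set.Icc (0 : ℝ) 1 ∩ {t | φ t = 1}).Nonempty := by
    obtain ⟨t, ht, h⟩ := intermediate_value_Icc (zero_le_one' ℝ) hφ.continuousOn
      (show (1 : ℝ) ∈ Set.Icc (φ 0) (φ 1) from ⟨by rw [hφ0]; norm_num, hφ1⟩)
    exact ⟨t, ht, h⟩
  obtain ⟨t, ⟨ht, hφt⟩, hleast⟩ := (isCompact_Icc.inter_right
    (isClosed_eq hφ continuous_const)).exists_isLeast hne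
  refine ⟨γ.extend '' Set.Icc 0 t, isPreconnected_Icc.image _ γ.continuous_extend.continuousOn, ?_,
    ⟨0, ⟨le_rfl, ht.1⟩, by simp⟩, γ.extend t, ⟨t, ⟨ht.1, le_rfl⟩, rfl⟩, ?_⟩
  · rintro _ ⟨s, hs, rfl⟩
    refine ⟨?_, ?_⟩
    · rw [Path.extend_apply γ ⟨hs.1, hs.2.trans ht.2⟩]
      exact hγ _
    · rw [mem_closedBall, dist_eq_norm]
      by_contra! hcon
      obtain ⟨u, hu, h⟩ := intermediate_value_Icc hs.1 hφ.continuousOn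
        (show (1 : ℝ) ∈ Set.Icc (φ 0) (φ s) from ⟨by rw [hφ0]; norm_num, hcon.le⟩)
      have h1 := hleast ⟨⟨hu.1, hu.2.trans (hs.2.trans ht.2)⟩, h⟩
      have h2 : s = t := le_antisymm hs.2 (h1.trans hu.2)
      rw [h2] at hcon
      exact absurd hφt (ne_of_gt hcon)
  · rw [norm_sub_rev]; exact hφt

lemma norm_sub_one_le_of_re_pos {s : ℂ} (hs : 0 < s.re) : ‖s - 1‖ ≤ ‖s ^ 2 - 1‖ := by
  have h1 : 1 ≤ ‖s + 1‖ := by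
    refine le_trans ?_ (Complex.re_le_norm _)
    simp; linarith
  have h2 : s ^ 2 - 1 = (s - 1) * (s + 1) := by ring
  rw [h2, norm_mul]
  exact le_mul_of_one_le_right (norm_nonneg _) h1

lemma re_pos_of_norm_sub_one_lt {s : ℂ} (hs : ‖s - 1‖ < 1) : 0 < s.re := by
  have := (abs_le.mp ((Complex.abs_re_le_norm (s - 1)))).1
  simp at this
  linarith

lemma exists_sqrt_quotient_local {K : Set ℂ} [CompactSpace K] (hc : IsPreconnected Kᶜ) {x y : ℂ}
    (hy : y ∉ K) (hxy : ∀ z : K, 2 * ‖y - x‖ ≤ ‖(z : ℂ) - y‖) :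
    ∃ s ∈ polyClosure K, ∀ z : K, s z ^ 2 * ((z : ℂ) - y) = z - x ∧ 0 < (s z).re := by
  obtain ⟨v, hv, hvy⟩ := exists_inv_mem_polyClosure hc hy
  obtain ⟨s, hs, h⟩ := exists_sqrt_mem_polyClosure (u := (y - x) • v)
    (Subalgebra.smul_mem _ hv _) (fun z => by
      have h1 : ‖v z‖ * ‖(z : ℂ) - y‖ = 1 := by rw [← norm_mul, hvy]; simp
      have h2 := hxy z
      simp only [ContinuousMap.smul_apply, smul_eq_mul, norm_mul]
      have h3 := mul_le_mul_of_nonneg_left h2 (norm_nonneg (v z))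
      linarith)
  refine ⟨s, hs, fun z => ⟨?_, (h z).2⟩⟩
  rw [(h z).1]
  simp only [ContinuousMap.smul_apply, smul_eq_mul]
  linear_combination (y - x) * hvy z

lemma exists_sqrt_quotient {K : Set ℂ} [CompactSpace K] (hK : IsClosed K)
    (hc : IsPreconnected Kᶜ) {p : ℂ} {G : Set ℂ} (hG : IsPreconnected G)
    (hGK : G ⊆ Kᶜ ∩ closedBall p 1) {a b : ℂ} (ha : a ∈ G) (hb : b ∈ G) :
    ∃ s ∈ polyClosure K, ∀ z : K, s z ^ 2 * ((z : ℂ) - b) = z - a ∧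
      (10 ≤ ‖(z : ℂ) - p‖ → 0 < (s z).re) := by
  have key : ∀ x ∈ G, ∀ y ∈ G, ∀ s : C(K, ℂ), (∀ z : K, s z ^ 2 * ((z : ℂ) - y) = z - x ∧
      (10 ≤ ‖(z : ℂ) - p‖ → 0 < (s z).re)) → ∀ z : K, 10 ≤ ‖(z : ℂ) - p‖ →
      ‖s z - 1‖ ≤ 1 / 4 := by
    intro x hx y hy s hs z hz
    refine (norm_sub_one_le_of_re_pos ((hs z).2 hz)).trans ?_
    have hxp := (hGK hx).2
    have hyp := (hGK hy).2
    rw [mem_closedBall, dist_eq_norm] at hxp hyp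
    have h1 : 9 ≤ ‖(z : ℂ) - y‖ := by
      have := norm_sub_norm_le ((z : ℂ) - p) (y - p)
      rw [sub_sub_sub_cancel_right] at this
      linarith
    have h2 : ‖y - x‖ ≤ 2 := by
      have := norm_sub_le (y - p) (x - p)
      rw [sub_sub_sub_cancel_right] at this
      linarith
    have h3 : (s z ^ 2 - 1) * ((z : ℂ) - y) = y - x := by linear_combination (hs z).1
    have h4 := congrArg norm h3
    rw [norm_mul] at h4
    have h5 := mul_le_mul_of_nonneg_left h1 (norm_nonneg (s z ^ 2 - 1))
    linarith
  refine hG.induction₂' (fun x y => ∃ s ∈ polyClosure K, ∀ z : K,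
    s z ^ 2 * ((z : ℂ) - y) = z - x ∧ (10 ≤ ‖(z : ℂ) - p‖ → 0 < (s z).re)) ?_ ?_ ha hb
  · intro x hx
    obtain ⟨δ, hδ, hball⟩ := Metric.isOpen_iff.mp hK.isOpen_compl x (hGK hx).1
    filter_upwards [self_mem_nhdsWithin, mem_nhdsWithin_of_mem_nhds (ball_mem_nhds x
      (show (0 : ℝ) < δ / 3 by positivity))] with y hyG hy
    rw [mem_ball, dist_eq_norm] at hy
    have hz : ∀ z : K, δ ≤ ‖(z : ℂ) - x‖ := fun z => by
      by_contra! h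
      exact hball (by rwa [mem_ball, dist_eq_norm]) z.2
    have hz' : ∀ z : K, 2 * δ / 3 ≤ ‖(z : ℂ) - y‖ := fun z => by
      have := norm_sub_le ((z : ℂ) - y) (x - y)
      rw [sub_sub_sub_cancel_right, norm_sub_rev x y] at this
      linarith [hz z]
    constructor
    · obtain ⟨s, hs, h⟩ := exists_sqrt_quotient_local hc (hGK hyG).1 (x := x)
        (fun z => by linarith [hz' z])
      exact ⟨s, hs, fun z => ⟨(h z).1, fun _ => (h z).2⟩⟩
    · obtain ⟨s, hs, h⟩ := exists_sqrt_quotient_local hc (hGK hx).1 (x := y)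
        (fun z => by rw [norm_sub_rev x y]; linarith [hz z])
      exact ⟨s, hs, fun z => ⟨(h z).1, fun _ => (h z).2⟩⟩
  · rintro x y w hx hy hw ⟨s, hs, h⟩ ⟨t, ht, h'⟩
    refine ⟨s * t, mul_mem hs ht, fun z => ⟨?_, fun hz => re_pos_of_norm_sub_one_lt ?_⟩⟩
    · simp only [ContinuousMap.mul_apply]
      linear_combination (h z).1 + s z ^ 2 * (h' z).1
    · have h1 := key x hx y hy s h z hz
      have h2 := key y hy w hw t h' z hz
      have h3 : (s * t) z - 1 = (s z - 1) * (t z - 1) + (s z - 1) + (t z - 1) := by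
        simp only [ContinuousMap.mul_apply]; ring
      rw [h3]
      have h4 := norm_add₃_le (a := (s z - 1) * (t z - 1)) (b := s z - 1) (c := t z - 1)
      rw [norm_mul] at h4
      nlinarith [norm_nonneg (s z - 1), norm_nonneg (t z - 1)]

/-- A radial kernel, integrable on the plane, dominating the errors of the approximation of
Cauchy kernels. -/
def errKernel (r : ℝ) : ℝ := r⁻¹ * ((1 + r) ^ 2)⁻¹

lemma kernel_bound_near {t Q : ℝ} (ht : 0 < t) (ht' : t ≤ 23) (hQ : Q ≤ 452000 + t⁻¹) :
    Q ≤ 10 ^ 10 * errKernel t := by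
  refine hQ.trans ?_
  have h1 : (452000 + t⁻¹) = (452000 * t + 1) * t⁻¹ := by field_simp
  have h2 : (10 : ℝ) ^ 10 * errKernel t = 10 ^ 10 * ((1 + t) ^ 2)⁻¹ * t⁻¹ := by
    rw [errKernel]; ring
  rw [h1, h2]
  refine mul_le_mul_of_nonneg_right ?_ (inv_nonneg.mpr ht.le)
  rw [← div_eq_mul_inv, le_div_iff₀ (by positivity)]
  have : (1 + t) ^ 2 ≤ 24 ^ 2 := pow_le_pow_left₀ (by linarith) (by linarith) 2
  nlinarith

/-- The approximation of Cauchy kernels far away from the poles. -/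
lemma kernel_bound_far {y d η g : ℂ} (hd : ‖d‖ = 1) (hη : ‖η‖ ≤ 4) (hy : 19 ≤ ‖y‖) {w : ℂ}
    (hw : w ^ 2 = y ^ 2 - d ^ 2 / 4) (hre : 0 < (w / y).re) (hg : g = 8 / d ^ 2 * (y - w)) :
    ‖g + η * g ^ 2 - (y - η)⁻¹‖ ≤ 10 ^ 10 * errKernel ‖y - η‖ := by
  have hd0 : d ≠ 0 := fun h => by simp [h] at hd
  have hY : 0 < ‖y‖ := by linarith
  have hy0 : y ≠ 0 := norm_pos_iff.mp hY
  set Y := ‖y‖ with hYdef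
  set t := ‖y - η‖ with htdef
  have ht : Y - 4 ≤ t := by have := norm_sub_norm_le y η; linarith
  have ht' : t ≤ Y + 4 := by have := norm_sub_le y η; linarith
  have hyη : y - η ≠ 0 := norm_pos_iff.mp (by rw [← htdef]; linarith)
  have h1 : Y ≤ ‖y + w‖ := by
    have h : 1 ≤ ‖w / y + 1‖ := by
      refine le_trans ?_ (Complex.re_le_norm _)
      simp only [Complex.add_re, Complex.one_re]; linarith
    have h2 : y + w = y * (w / y + 1) := by field_simp; ring
    rw [h2, norm_mul]
    exact le_mul_of_one_le_right (norm_nonneg _) h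
  have hyw : y + w ≠ 0 := norm_pos_iff.mp (hY.trans_le h1)
  have h2 : g * (y + w) = 2 := by
    rw [hg]; field_simp; linear_combination (-8) * hw
  have h3 : ‖g‖ ≤ 2 * Y⁻¹ := by
    have := congrArg norm h2
    rw [norm_mul, Complex.norm_ofNat] at this
    rw [← div_eq_mul_inv, le_div_iff₀ hY]
    nlinarith [norm_nonneg g]
  have h4 : ‖y - w‖ ≤ Y⁻¹ := by
    have h : (y - w) * (y + w) = d ^ 2 / 4 := by linear_combination -hw
    have := congrArg norm h
    rw [norm_mul, norm_div, norm_pow, hd, Complex.norm_ofNat] at this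
    rw [← one_div, le_div_iff₀ hY]
    nlinarith [norm_nonneg (y - w)]
  have h5 : ‖g - y⁻¹‖ ≤ Y⁻¹ ^ 3 := by
    have h : g - y⁻¹ = (g / 2) * ((y - w) * y⁻¹) := by
      field_simp; linear_combination h2
    rw [h, norm_mul, norm_mul, norm_div, norm_inv, Complex.norm_ofNat]
    have e1 : ‖g‖ / 2 ≤ Y⁻¹ := by linarith
    calc ‖g‖ / 2 * (‖y - w‖ * Y⁻¹) ≤ Y⁻¹ * (Y⁻¹ * Y⁻¹) := by gcongr
      _ = _ := by ring
  have h6 : ‖g + y⁻¹‖ ≤ 3 * Y⁻¹ := by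
    have := norm_add_le g y⁻¹
    rw [norm_inv] at this
    linarith
  have e : g + η * g ^ 2 - (y - η)⁻¹ = (g - y⁻¹) + η * ((g - y⁻¹) * (g + y⁻¹))
      - η ^ 2 * (y⁻¹ ^ 2 * (y - η)⁻¹) := by
    field_simp; ring
  have h7 : ‖g + η * g ^ 2 - (y - η)⁻¹‖ ≤ Y⁻¹ ^ 3 + 4 * (Y⁻¹ ^ 3 * (3 * Y⁻¹))
      + 4 ^ 2 * (Y⁻¹ ^ 2 * t⁻¹) := by
    rw [e]
    refine (norm_sub_le _ _).trans (add_le_add ((norm_add_le _ _).trans (add_le_add h5 ?_)) ?_)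
    · rw [norm_mul, norm_mul]; gcongr
    · rw [norm_mul, norm_mul, norm_pow, norm_pow, norm_inv, norm_inv]
      gcongr
  refine h7.trans ?_
  have ht0 : 0 < t := by linarith
  have hYt : Y⁻¹ ≤ 2 * (1 + t)⁻¹ := by
    rw [← div_eq_mul_inv, le_div_iff₀ (by linarith), inv_mul_eq_div, div_le_iff₀ hY]
    linarith
  have hYt' : Y⁻¹ ≤ 2 * t⁻¹ := by
    rw [← div_eq_mul_inv, le_div_iff₀ (by linarith), inv_mul_eq_div, div_le_iff₀ hY]
    linarith
  have hY1 : Y⁻¹ ≤ 1 := inv_le_one_of_one_le₀ (by linarith)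
  have hYn : 0 ≤ Y⁻¹ := by positivity
  have a2 : Y⁻¹ ^ 2 ≤ 4 * ((1 + t) ^ 2)⁻¹ := by
    calc Y⁻¹ ^ 2 ≤ (2 * (1 + t)⁻¹) ^ 2 := pow_le_pow_left₀ hYn hYt 2
      _ = _ := by rw [mul_pow, inv_pow]; norm_num
  have a3 : Y⁻¹ ^ 2 * t⁻¹ ≤ 4 * errKernel t := by
    rw [errKernel]
    calc Y⁻¹ ^ 2 * t⁻¹ ≤ (4 * ((1 + t) ^ 2)⁻¹) * t⁻¹ := by gcongr
      _ = _ := by ring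
  have a4 : Y⁻¹ ^ 3 ≤ 8 * errKernel t := by
    calc Y⁻¹ ^ 3 = Y⁻¹ ^ 2 * Y⁻¹ := by ring
      _ ≤ Y⁻¹ ^ 2 * (2 * t⁻¹) := by gcongr
      _ ≤ _ := by linarith
  have a5 : Y⁻¹ ^ 3 * (3 * Y⁻¹) ≤ 3 * Y⁻¹ ^ 3 := by
    nlinarith [pow_nonneg hYn 3]
  have a6 : 0 ≤ errKernel t := by rw [errKernel]; positivity
  linarith

lemma exists_approx_cauchy_kernel {K : Set ℂ} [CompactSpace K] (hK : IsCompact K)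
    (hc : IsConnected Kᶜ) {p : ℂ} (hp : p ∉ K) :
    ∃ g ∈ polyClosure K, ∃ m : ℂ, ∀ ζ ∈ ball p 3, ∀ z : K, (z : ℂ) ≠ ζ →
      ‖g z + (ζ - m) * g z ^ 2 - ((z : ℂ) - ζ)⁻¹‖ ≤ 10 ^ 10 * errKernel ‖(z : ℂ) - ζ‖ := by
  obtain ⟨G, hG, hGK, hpG, b, hbG, hpb⟩ := exists_preconnected_to_sphere hK hc hp
  obtain ⟨s, hs, h⟩ := exists_sqrt_quotient hK.isClosed hc.isPreconnected hG hGK hpG hbG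
  set m : ℂ := (p + b) / 2 with hm
  set d : ℂ := p - b with hd
  have hd0 : d ≠ 0 := norm_pos_iff.mp (by rw [hpb]; norm_num)
  have hid : ∀ c : ℂ, (X - C c).toContinuousMapOn K ∈ polyClosure K := fun c =>
    toContinuousMapOn_mem_polyClosure K _
  have hpm : ‖p - m‖ = 1 / 2 := by
    have : p - m = d / 2 := by rw [hm, hd]; ring
    rw [this, norm_div, hpb, Complex.norm_ofNat]
  have hbm : ‖m - b‖ = 1 / 2 := by
    have : m - b = d / 2 := by rw [hm, hd]; ring
    rw [this, norm_div, hpb, Complex.norm_ofNat]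
  refine ⟨(8 / d ^ 2) • ((X - C m).toContinuousMapOn K - (X - C b).toContinuousMapOn K * s),
    Subalgebra.smul_mem _ (sub_mem (hid m) (mul_mem (hid b) hs)) _, m, fun ζ hζ z hzζ => ?_⟩
  set w : ℂ := ((z : ℂ) - b) * s z with hw
  set g : ℂ := 8 / d ^ 2 * ((z : ℂ) - m - w) with hg
  have hgz : ((8 / d ^ 2) • ((X - C m).toContinuousMapOn K -
      (X - C b).toContinuousMapOn K * s)) z = g := by
    simp [hg, hw]
  rw [hgz]
  clear_value g w
  rw [mem_ball, dist_eq_norm] at hζ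
  have hη : ‖ζ - m‖ ≤ 4 := by
    have := norm_add_le (ζ - p) (p - m)
    rw [sub_add_sub_cancel] at this
    linarith
  have hw2 : w ^ 2 = ((z : ℂ) - p) * (z - b) := by
    rw [hw]; linear_combination ((z : ℂ) - b) * (h z).1
  have hzb := norm_add_le ((z : ℂ) - p) (p - b)
  rw [sub_add_sub_cancel, hpb] at hzb
  have hzm := norm_add_le ((z : ℂ) - p) (p - m)
  rw [sub_add_sub_cancel, hpm] at hzm
  rcases lt_or_ge ‖(z : ℂ) - p‖ 20 with hz | hz
  · refine kernel_bound_near (norm_pos_iff.mpr (sub_ne_zero.mpr hzζ)) ?_ ?_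
    · have := norm_sub_le ((z : ℂ) - p) (ζ - p)
      rw [sub_sub_sub_cancel_right] at this
      linarith
    · have hwn : ‖w‖ ≤ 21 := by
        have h1 := congrArg norm hw2
        rw [norm_pow, norm_mul] at h1
        have h2 : ‖w‖ ^ 2 ≤ 21 ^ 2 := by
          rw [h1]
          nlinarith [norm_nonneg ((z : ℂ) - p), norm_nonneg ((z : ℂ) - b)]
        exact (abs_le_of_sq_le_sq' h2 (by norm_num)).2
      have hgn : ‖g‖ ≤ 336 := by
        rw [hg, norm_mul, norm_div, norm_pow, hpb, Complex.norm_ofNat]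
        have := norm_sub_le ((z : ℂ) - m) w
        linarith
      refine (norm_sub_le _ _).trans (add_le_add ((norm_add_le _ _).trans ?_) (norm_inv _).le)
      rw [norm_mul, norm_pow]
      have : ‖ζ - m‖ * ‖g‖ ^ 2 ≤ 4 * 336 ^ 2 := by gcongr
      linarith
  · have hy : 39 / 2 ≤ ‖(z : ℂ) - m‖ := by
      have := norm_sub_norm_le ((z : ℂ) - p) (m - p)
      rw [sub_sub_sub_cancel_right, norm_sub_rev m p, hpm] at this
      linarith
    have hzb' : 19 ≤ ‖(z : ℂ) - b‖ := by
      have := norm_sub_norm_le ((z : ℂ) - p) (b - p)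
      rw [sub_sub_sub_cancel_right, norm_sub_rev b p, hpb] at this
      linarith
    have hy0 : (z : ℂ) - m ≠ 0 := norm_pos_iff.mp (by linarith)
    have key := kernel_bound_far (y := (z : ℂ) - m) (η := ζ - m) (w := w) (g := g) hpb hη
      (by linarith) (by rw [hw2, hm, hd]; ring) ?_ hg
    · rwa [sub_sub_sub_cancel_right] at key
    · apply re_pos_of_norm_sub_one_lt
      have h1 : ‖s z - 1‖ ≤ 1 / 19 := by
        refine (norm_sub_one_le_of_re_pos ((h z).2 (by linarith))).trans ?_
        have h3 : (s z ^ 2 - 1) * ((z : ℂ) - b) = -d := by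
          rw [hd]; linear_combination (h z).1
        have h4 := congrArg norm h3
        rw [norm_mul, norm_neg, hpb] at h4
        nlinarith [norm_nonneg (s z ^ 2 - 1)]
      have h2 : ‖(m - b) / ((z : ℂ) - m)‖ ≤ 1 / 39 := by
        rw [norm_div, hbm, div_le_iff₀ (by linarith)]; linarith
      have e : w / ((z : ℂ) - m) - 1 = (s z - 1) * ((m - b) / ((z : ℂ) - m)) +
          (s z - 1) + (m - b) / ((z : ℂ) - m) := by
        rw [hw]; field_simp; ring
      rw [e]
      have h4 := norm_add₃_le (a := (s z - 1) * ((m - b) / ((z : ℂ) - m))) (b := s z - 1)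
        (c := (m - b) / ((z : ℂ) - m))
      rw [norm_mul] at h4
      nlinarith [norm_nonneg (s z - 1), norm_nonneg ((m - b) / ((z : ℂ) - m))]

open MeasureTheory

lemma integrable_errKernel_norm : Integrable fun w : ℂ => errKernel ‖w‖ := by
  rw [integrable_fun_norm_addHaar volume (f := errKernel)]
  have h := (integrable_inv_one_add_sq).integrableOn (s := Set.Ioi (0 : ℝ))
  refine Integrable.mono' h ?_ ?_
  · refine Measurable.aestronglyMeasurable ?_
    unfold errKernel
    fun_prop
  · filter_upwards [ae_restrict_mem measurableSet_Ioi] with r hr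
    have hr' : (0 : ℝ) < r := hr
    rw [Complex.finrank_real_complex, errKernel, smul_eq_mul]
    norm_num
    rw [abs_of_pos hr', mul_inv_cancel_left₀ hr'.ne']
    exact inv_anti₀ (by positivity) (by nlinarith)

lemma integrableOn_norm_inv (R : ℝ) :
    Integrable fun w : ℂ => Set.indicator (Set.Iic R) (fun r : ℝ => r⁻¹) ‖w‖ := by
  rw [integrable_fun_norm_addHaar volume (f := Set.indicator (Set.Iic R) (fun r : ℝ => r⁻¹))]
  have h : IntegrableOn (Set.indicator (Set.Iic R) fun _ => (1 : ℝ)) (Set.Ioi 0) := by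
    rw [IntegrableOn, integrable_indicator_iff measurableSet_Iic, IntegrableOn,
      Measure.restrict_restrict measurableSet_Iic, Set.inter_comm, Set.Ioi_inter_Iic]
    exact integrableOn_const (by simp)
  refine Integrable.mono' h ?_ ?_
  · refine Measurable.aestronglyMeasurable ?_
    exact (measurable_id.pow_const _).smul (measurable_inv.indicator measurableSet_Iic)
  · filter_upwards [ae_restrict_mem measurableSet_Ioi] with r hr
    have hr' : (0 : ℝ) < r := hr
    by_cases hrR : r ∈ Set.Iic R
    · simp [Set.indicator_of_mem hrR, hr'.ne']
    · simp [Set.indicator_of_notMem hrR]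

lemma integrable_mul_cauchy {ψ : ℂ → ℂ} (hm : Measurable ψ) {B R : ℝ} (hb : ∀ ζ, ‖ψ ζ‖ ≤ B)
    (hs : ∀ ζ, ψ ζ ≠ 0 → ‖ζ‖ ≤ R) (z : ℂ) : Integrable fun ζ => ψ ζ * (z - ζ)⁻¹ := by
  have h := ((integrableOn_norm_inv (‖z‖ + R)).comp_sub_left z).const_mul B
  refine Integrable.mono' h (by fun_prop) (Eventually.of_forall fun ζ => ?_)
  have hB : 0 ≤ B := (norm_nonneg _).trans (hb 0)
  by_cases h0 : ψ ζ = 0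
  · rw [h0, zero_mul, norm_zero]
    exact mul_nonneg hB (Set.indicator_apply_nonneg fun _ => by positivity)
  · rw [Set.indicator_of_mem (show ‖z - ζ‖ ∈ Set.Iic (‖z‖ + R) from
      (norm_sub_le _ _).trans (by linarith [hs ζ h0])), norm_mul, norm_inv]
    exact mul_le_mul_of_nonneg_right (hb ζ) (by positivity)

lemma integrable_of_bounded_support {ψ : ℂ → ℂ} (hm : Measurable ψ) {B R : ℝ}
    (hb : ∀ ζ, ‖ψ ζ‖ ≤ B) (hs : ∀ ζ, ψ ζ ≠ 0 → ‖ζ‖ ≤ R) : Integrable ψ := by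
  have h : IntegrableOn ψ (closedBall 0 R) :=
    IntegrableOn.of_bound measure_closedBall_lt_top hm.aestronglyMeasurable B
      (Eventually.of_forall hb)
  refine (integrableOn_iff_integrable_of_support_subset fun ζ hζ => ?_).mp h
  simpa using hs ζ hζ

lemma integrable_norm_mul_errKernel {ψ : ℂ → ℂ} (hm : Measurable ψ) {B : ℝ}
    (hb : ∀ ζ, ‖ψ ζ‖ ≤ B) (z : ℂ) : Integrable fun ζ => ‖ψ ζ‖ * errKernel ‖z - ζ‖ :=
  (integrable_errKernel_norm.comp_sub_left z).bdd_mul hm.norm.aestronglyMeasurable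
    (Eventually.of_forall fun ζ => by simpa using hb ζ)

lemma exists_approx_cauchy_transform_of_ball {K : Set ℂ} [CompactSpace K] (hK : IsCompact K)
    (hc : IsConnected Kᶜ) {p : ℂ} (hp : p ∉ K) {ψ : ℂ → ℂ} (hm : Measurable ψ) {B : ℝ}
    (hb : ∀ ζ, ‖ψ ζ‖ ≤ B) (hs : ∀ ζ, ψ ζ ≠ 0 → ζ ∈ ball p 3) :
    ∃ F ∈ polyClosure K, ∀ z : K, ‖F z - ∫ ζ, ψ ζ * ((z : ℂ) - ζ)⁻¹‖ ≤
      10 ^ 10 * ∫ ζ, ‖ψ ζ‖ * errKernel ‖(z : ℂ) - ζ‖ := by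
  obtain ⟨g, hg, m, h⟩ := exists_approx_cauchy_kernel hK hc hp
  have hs' : ∀ ζ, ψ ζ ≠ 0 → ‖ζ‖ ≤ ‖p‖ + 3 := fun ζ hζ => by
    have h1 := hs ζ hζ
    rw [mem_ball, dist_eq_norm] at h1
    have := norm_add_le p (ζ - p)
    rw [add_sub_cancel] at this
    linarith
  have hi := integrable_of_bounded_support hm hb hs'
  have hi2 : Integrable fun ζ => ψ ζ * (ζ - m) := by
    refine integrable_of_bounded_support (B := B * (‖p‖ + 3 + ‖m‖)) (R := ‖p‖ + 3)
      (by fun_prop) (fun ζ => ?_) (fun ζ hζ => hs' ζ (left_ne_zero_of_mul hζ))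
    by_cases h0 : ψ ζ = 0
    · rw [h0, zero_mul, norm_zero]
      exact mul_nonneg ((norm_nonneg _).trans (hb 0)) (by positivity)
    · rw [norm_mul]
      have := norm_sub_le ζ m
      have := hs' ζ h0
      exact mul_le_mul (hb ζ) (by linarith) (norm_nonneg _) ((norm_nonneg _).trans (hb 0))
  refine ⟨(∫ ζ, ψ ζ) • g + (∫ ζ, ψ ζ * (ζ - m)) • g ^ 2, add_mem (Subalgebra.smul_mem _ hg _)
    (Subalgebra.smul_mem _ (pow_mem hg 2) _), fun z => ?_⟩
  have hi3 := integrable_mul_cauchy hm hb hs' (z : ℂ)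
  have hi12 : Integrable fun ζ => ψ ζ * g z + ψ ζ * (ζ - m) * g z ^ 2 :=
    (hi.mul_const _).add (hi2.mul_const _)
  have e : ((∫ ζ, ψ ζ) • g + (∫ ζ, ψ ζ * (ζ - m)) • g ^ 2) z - ∫ ζ, ψ ζ * ((z : ℂ) - ζ)⁻¹ =
      ∫ ζ, ψ ζ * (g z + (ζ - m) * g z ^ 2 - ((z : ℂ) - ζ)⁻¹) := by
    simp only [ContinuousMap.add_apply, ContinuousMap.smul_apply, ContinuousMap.pow_apply,
      smul_eq_mul]
    rw [← integral_mul_const, ← integral_mul_const, ← integral_add (hi.mul_const _)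
      (hi2.mul_const _), ← integral_sub hi12 hi3]
    congr 1; ext ζ; ring
  rw [e, ← integral_const_mul]
  refine norm_integral_le_of_norm_le ((integrable_norm_mul_errKernel hm hb z).const_mul _) ?_
  have hz : ∀ᵐ ζ : ℂ, ζ ≠ (z : ℂ) := by
    rw [ae_iff]; simp
  filter_upwards [hz] with ζ hζ
  by_cases h0 : ψ ζ = 0
  · simp [h0]
  · rw [norm_mul]
    calc _ ≤ ‖ψ ζ‖ * (10 ^ 10 * errKernel ‖(z : ℂ) - ζ‖) :=
          mul_le_mul_of_nonneg_left (h ζ (hs ζ h0) z hζ.symm) (norm_nonneg _)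
      _ = _ := by ring

lemma exists_approx_cauchy_transform {K : Set ℂ} [CompactSpace K] (hK : IsCompact K)
    (hc : IsConnected Kᶜ) (t : Finset ℂ) (ht : ∀ p ∈ t, p ∉ K) {B R : ℝ} :
    ∀ ψ : ℂ → ℂ, Measurable ψ → (∀ ζ, ‖ψ ζ‖ ≤ B) → (∀ ζ, ψ ζ ≠ 0 → ‖ζ‖ ≤ R) →
    (∀ ζ, ψ ζ ≠ 0 → ∃ p ∈ t, ζ ∈ ball p 3) →
    ∃ F ∈ polyClosure K, ∀ z : K, ‖F z - ∫ ζ, ψ ζ * ((z : ℂ) - ζ)⁻¹‖ ≤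
      10 ^ 10 * ∫ ζ, ‖ψ ζ‖ * errKernel ‖(z : ℂ) - ζ‖ := by
  induction t using Finset.induction_on with
  | empty =>
    intro ψ _ _ _ hs
    have h0 : ψ = 0 := by
      ext ζ
      by_contra h
      simpa using hs ζ h
    exact ⟨0, zero_mem _, fun z => by simp [h0]⟩
  | insert p t hpt ih =>
    intro ψ hm hb hR hs
    have hle : ∀ (s : Set ℂ) ζ, ‖s.indicator ψ ζ‖ ≤ B := fun s ζ =>
      (norm_indicator_le_norm_self ψ ζ).trans (hb ζ)
    have hne : ∀ (s : Set ℂ) ζ, s.indicator ψ ζ ≠ 0 → ζ ∈ s ∧ ψ ζ ≠ 0 := fun s ζ h =>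
      Set.indicator_apply_ne_zero.mp h
    have hm1 : Measurable ((ball p 3).indicator ψ) := hm.indicator measurableSet_ball
    have hm2 : Measurable ((ball p 3)ᶜ.indicator ψ) := hm.indicator measurableSet_ball.compl
    obtain ⟨F₁, hF₁, h₁⟩ := exists_approx_cauchy_transform_of_ball hK hc
      (ht p (Finset.mem_insert_self p t)) hm1 (hle _) (fun ζ h => (hne _ ζ h).1)
    obtain ⟨F₂, hF₂, h₂⟩ := ih (fun x hx => ht x (Finset.mem_insert_of_mem hx)) _ hm2 (hle _)
      (fun ζ h => hR ζ (hne _ ζ h).2) (fun ζ h => by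
        obtain ⟨x, hx, hζ⟩ := hs ζ (hne _ ζ h).2
        rcases Finset.mem_insert.mp hx with rfl | hx
        · exact absurd hζ (hne _ ζ h).1
        · exact ⟨x, hx, hζ⟩)
    refine ⟨F₁ + F₂, add_mem hF₁ hF₂, fun z => ?_⟩
    have hsplit : ∀ ζ, ψ ζ = (ball p 3).indicator ψ ζ + (ball p 3)ᶜ.indicator ψ ζ := fun ζ =>
      (congrFun (Set.indicator_self_add_compl (ball p 3) ψ) ζ).symm
    have hsplitn : ∀ ζ, ‖ψ ζ‖ = ‖(ball p 3).indicator ψ ζ‖ + ‖(ball p 3)ᶜ.indicator ψ ζ‖ := by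
      intro ζ
      by_cases h : ζ ∈ ball p 3 <;> simp [h]
    have e1 : ∫ ζ, ψ ζ * ((z : ℂ) - ζ)⁻¹ = (∫ ζ, (ball p 3).indicator ψ ζ * ((z : ℂ) - ζ)⁻¹) +
        ∫ ζ, (ball p 3)ᶜ.indicator ψ ζ * ((z : ℂ) - ζ)⁻¹ := by
      rw [← integral_add (integrable_mul_cauchy hm1 (hle _) (fun ζ h => hR ζ (hne _ ζ h).2) _)
        (integrable_mul_cauchy hm2 (hle _) (fun ζ h => hR ζ (hne _ ζ h).2) _)]
      congr 1; ext ζ; rw [hsplit ζ]; ring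
    have e2 : ∫ ζ, ‖ψ ζ‖ * errKernel ‖(z : ℂ) - ζ‖ =
        (∫ ζ, ‖(ball p 3).indicator ψ ζ‖ * errKernel ‖(z : ℂ) - ζ‖) +
        ∫ ζ, ‖(ball p 3)ᶜ.indicator ψ ζ‖ * errKernel ‖(z : ℂ) - ζ‖ := by
      rw [← integral_add (integrable_norm_mul_errKernel hm1 (hle _) _)
        (integrable_norm_mul_errKernel hm2 (hle _) _)]
      congr 1; ext ζ; rw [hsplitn ζ]; ring
    rw [e1, e2, ContinuousMap.add_apply, add_sub_add_comm, mul_add]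
    exact (norm_add_le _ _).trans (add_le_add (h₁ z) (h₂ z))

/-- The Cauchy integral `(2πi)⁻¹ ∮ f(u) du` over the unit circle centred at `ζ`. -/
def circleMean (f : ℂ → ℂ) (ζ : ℂ) : ℂ :=
  (2 * Real.pi * Complex.I)⁻¹ * ∮ u in C(ζ, 1), f u

lemma circleMean_eq (f : ℂ → ℂ) (ζ : ℂ) : circleMean f ζ = (2 * Real.pi * Complex.I)⁻¹ *
    ∫ θ in Set.Ioc 0 (2 * Real.pi), f (ζ + circleMap 0 1 θ) * (circleMap 0 1 θ * Complex.I) := by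
  rw [circleMean, circleIntegral, intervalIntegral.integral_of_le Real.two_pi_pos.le]
  congr 2; ext θ
  rw [deriv_circleMap, smul_eq_mul, mul_comm (f _)]
  congr 2
  simp [circleMap]

lemma continuous_circleMean {f : ℂ → ℂ} (hf : Continuous f) : Continuous (circleMean f) := by
  have : circleMean f = fun ζ => (2 * Real.pi * Complex.I)⁻¹ *
      ∫ θ in (0 : ℝ)..(2 * Real.pi), f (ζ + circleMap 0 1 θ) * (circleMap 0 1 θ * Complex.I) := by
    ext ζ
    rw [circleMean_eq, intervalIntegral.integral_of_le Real.two_pi_pos.le]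
  rw [this]
  refine continuous_const.mul ?_
  refine intervalIntegral.continuous_parametric_intervalIntegral_of_continuous' ?_ 0 (2 * Real.pi)
  have := continuous_circleMap 0 1
  unfold Function.uncurry
  fun_prop

lemma norm_circleMean_le {f : ℂ → ℂ} (hf : Continuous f) {ε : ℝ}
    (hε : ∀ x y, ‖x - y‖ ≤ 1 → ‖f x - f y‖ ≤ ε) (ζ : ℂ) : ‖circleMean f ζ‖ ≤ ε := by
  have h1 : ∮ u in C(ζ, 1), f u = ∮ u in C(ζ, 1), (f u - f ζ) := by
    rw [circleIntegral.integral_sub hf.continuousOn.circleIntegrable'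
      (continuous_const.continuousOn.circleIntegrable'),
      Complex.circleIntegral_eq_zero_of_differentiable_on_off_countable
      (f := fun _ => f ζ) zero_le_one Set.countable_empty continuousOn_const
      (fun _ _ => differentiableAt_const _), sub_zero]
  rw [circleMean, h1]
  have := circleIntegral.norm_two_pi_i_inv_smul_integral_le_of_norm_le_const (c := ζ) (R := 1)
    (f := fun u => f u - f ζ) (C := ε) zero_le_one (fun u hu => hε u ζ (by
      rw [mem_sphere, dist_eq_norm] at hu; exact hu.le))
  simpa using this

lemma exists_notMem_of_circleMean_ne_zero {K : Set ℂ} {f : ℂ → ℂ} (hf : Continuous f)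
    (hd : DifferentiableOn ℂ f (interior K)) {ζ : ℂ} (h : circleMean f ζ ≠ 0) :
    ∃ p, p ∉ K ∧ ζ ∈ ball p 2 := by
  by_contra! hcon
  refine h ?_
  have hsub : ball ζ 2 ⊆ interior K := by
    refine interior_maximal (fun p hp => ?_) isOpen_ball
    by_contra hpK
    exact hcon p hpK (mem_ball_comm.mp hp)
  rw [circleMean, Complex.circleIntegral_eq_zero_of_differentiable_on_off_countable zero_le_one
    Set.countable_empty hf.continuousOn fun z hz => ?_, mul_zero]
  exact hd.differentiableAt (isOpen_interior.mem_nhds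
    (hsub (ball_subset_ball one_le_two hz.1)))

lemma norm_le_of_circleMean_ne_zero {f : ℂ → ℂ} {R : ℝ} (hR : ∀ z, f z ≠ 0 → ‖z‖ ≤ R) {ζ : ℂ}
    (h : circleMean f ζ ≠ 0) : ‖ζ‖ ≤ R + 1 := by
  by_contra! hcon
  refine h ?_
  rw [circleMean_eq]
  have : ∀ θ : ℝ, f (ζ + circleMap 0 1 θ) = 0 := fun θ => by
    by_contra hne
    have h1 := hR _ hne
    have h2 := norm_sub_le (ζ + circleMap 0 1 θ) (circleMap 0 1 θ)
    rw [add_sub_cancel_right, norm_circleMap_zero, abs_one] at h2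
    linarith
  simp [this]

lemma integral_circleMean_mul_inv {f : ℂ → ℂ} (hf : Continuous f) {B R : ℝ}
    (hB : ∀ z, ‖f z‖ ≤ B) (hR : ∀ z, f z ≠ 0 → ‖z‖ ≤ R) (z : ℂ) :
    ∫ ζ, circleMean f ζ * (z - ζ)⁻¹ = ∫ u in ball z 1, f u := by
  set ν : Measure ℝ := volume.restrict (Set.Ioc 0 (2 * Real.pi)) with hν
  have hcm := continuous_circleMap 0 1
  set G : ℝ × ℂ → ℂ := fun x => f (x.2 + circleMap 0 1 x.1) * (z - x.2)⁻¹ *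
    (circleMap 0 1 x.1 * Complex.I) with hG
  set H : ℝ × ℂ → ℂ := fun x => f x.2 * (z - (x.2 - circleMap 0 1 x.1))⁻¹ *
    (circleMap 0 1 x.1 * Complex.I) with hH
  have hGi : Integrable G (ν.prod volume) := by
    have h := ((integrableOn_norm_inv (‖z‖ + R + 1)).comp_sub_left z).const_mul B
    refine Integrable.mono' (h.comp_snd ν) ?_ (Eventually.of_forall fun x => ?_)
    · refine Measurable.aestronglyMeasurable ?_
      have := hf.measurable
      have := hcm.measurable
      fun_prop
    · have hB0 : 0 ≤ B := (norm_nonneg _).trans (hB 0)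
      by_cases h0 : f (x.2 + circleMap 0 1 x.1) = 0
      · simp only [hG, h0, zero_mul, norm_zero]
        exact mul_nonneg hB0 (Set.indicator_apply_nonneg fun _ => by positivity)
      · have h2 := norm_sub_le (x.2 + circleMap 0 1 x.1) (circleMap 0 1 x.1)
        rw [add_sub_cancel_right, norm_circleMap_zero, abs_one] at h2
        have h3 := hR _ h0
        rw [Set.indicator_of_mem (show ‖z - x.2‖ ∈ Set.Iic (‖z‖ + R + 1) from
          (norm_sub_le _ _).trans (by linarith))]
        simp only [hG, norm_mul, norm_circleMap_zero, abs_one, Complex.norm_I, mul_one, norm_inv]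
        exact mul_le_mul_of_nonneg_right (hB _) (by positivity)
  have hHi : Integrable H (ν.prod volume) := by
    have hmp : MeasurePreserving (fun x : ℝ × ℂ => (x.1, x.2 - circleMap 0 1 x.1))
        (ν.prod volume) (ν.prod volume) := by
      refine (MeasurePreserving.id ν).skew_product (g := fun θ u => u - circleMap 0 1 θ) ?_
        (Eventually.of_forall fun θ => (measurePreserving_sub_right volume _).map_eq)
      have := hcm.measurable
      unfold Function.uncurry
      fun_prop
    have := hmp.integrable_comp_of_integrable hGi
    refine this.congr (Eventually.of_forall fun x => ?_)
    simp [hG, hH]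
  have e1 : ∫ ζ, circleMean f ζ * (z - ζ)⁻¹ =
      (2 * Real.pi * Complex.I)⁻¹ * ∫ ζ, ∫ θ, G (θ, ζ) ∂ν := by
    rw [← integral_const_mul]
    congr 1; ext ζ
    rw [circleMean_eq, mul_assoc, ← integral_mul_const]
    congr 2; ext θ; simp only [hG]; ring
  have e2 : ∫ ζ, ∫ θ, G (θ, ζ) ∂ν = ∫ θ, ∫ ζ, G (θ, ζ) ∂volume ∂ν :=
    (integral_integral_swap (f := fun θ ζ => G (θ, ζ)) hGi).symm
  have e3 : ∫ θ, ∫ ζ, G (θ, ζ) ∂volume ∂ν = ∫ θ, ∫ u, H (θ, u) ∂volume ∂ν := by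
    congr 1; ext θ
    rw [← integral_sub_right_eq_self (fun ζ => G (θ, ζ)) (circleMap 0 1 θ)]
    congr 1; ext u; simp [hG, hH]
  have e4 : ∫ θ, ∫ u, H (θ, u) ∂volume ∂ν = ∫ u, ∫ θ, H (θ, u) ∂ν :=
    integral_integral_swap (f := fun θ u => H (θ, u)) hHi
  have hin : ∀ u, ∫ θ, H (θ, u) ∂ν = f u * ∮ w in C(0, 1), (w - (u - z))⁻¹ := fun u => by
    rw [circleIntegral, intervalIntegral.integral_of_le Real.two_pi_pos.le, ← integral_const_mul]
    congr 1; ext θ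
    simp only [hH, deriv_circleMap, smul_eq_mul]
    rw [show z - (u - circleMap 0 1 θ) = circleMap 0 1 θ - (u - z) by ring]
    ring
  have e5 : ∫ u, ∫ θ, H (θ, u) ∂ν = ∫ u, (ball z 1).indicator
      (fun u => f u * (2 * Real.pi * Complex.I)) u := by
    refine integral_congr_ae ?_
    have hz : ∀ᵐ u : ℂ, u ∉ sphere z 1 := by
      rw [ae_iff]; simpa only [not_not, Set.ofPred_mem_eq] using Measure.addHaar_sphere volume z 1
    filter_upwards [hz] with u hu
    rw [hin]
    by_cases hb : u ∈ ball z 1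
    · rw [Set.indicator_of_mem hb, circleIntegral.integral_sub_inv_of_mem_ball]
      rw [mem_ball, dist_eq_norm] at hb
      simpa using hb
    · rw [Set.indicator_of_notMem hb]
      have h1 : 1 < ‖u - z‖ := by
        rw [mem_ball, dist_eq_norm, not_lt] at hb
        rw [mem_sphere, dist_eq_norm] at hu
        exact lt_of_le_of_ne hb (Ne.symm hu)
      have hne : ∀ w ∈ closedBall (0 : ℂ) 1, w - (u - z) ≠ 0 := fun w hw h => by
        rw [sub_eq_zero] at h
        rw [h] at hw
        simp at hw
        linarith
      rw [Complex.circleIntegral_eq_zero_of_differentiable_on_off_countable zero_le_one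
        Set.countable_empty (f := fun w => (w - (u - z))⁻¹)
        (ContinuousOn.inv₀ (by fun_prop) hne) fun w hw => ?_, mul_zero]
      exact DifferentiableAt.inv (by fun_prop) (hne w (ball_subset_closedBall hw.1))
  rw [e1, e2, e3, e4, e5, integral_indicator measurableSet_ball, integral_mul_const]
  have := Complex.two_pi_I_ne_zero
  field_simp

lemma exists_approx_of_oscillation_le {K : Set ℂ} [CompactSpace K] (hK : IsCompact K)
    (hc : IsConnected Kᶜ) {f : ℂ → ℂ} (hf : Continuous f) {R : ℝ}
    (hR : ∀ z, f z ≠ 0 → ‖z‖ ≤ R) (hd : DifferentiableOn ℂ f (interior K)) {ε : ℝ}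
    (hε : ∀ x y, ‖x - y‖ ≤ 1 → ‖f x - f y‖ ≤ ε) :
    ∃ F ∈ polyClosure K, ∀ z : K,
      ‖F z - f z‖ ≤ ε * (1 + Real.pi⁻¹ * (10 ^ 10 * ∫ w : ℂ, errKernel ‖w‖)) := by
  have hcs : HasCompactSupport f := HasCompactSupport.of_support_subset_isCompact
    (isCompact_closedBall (0 : ℂ) R) fun z hz => by simpa using hR z hz
  obtain ⟨B, hB⟩ := hcs.exists_bound_of_continuous hf
  have hψ := continuous_circleMean hf
  have hψε := norm_circleMean_le hf hε
  have hε0 : 0 ≤ ε := (norm_nonneg _).trans (hψε 0)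
  obtain ⟨t, ht1, ht2⟩ : ∃ t : Finset ℂ, (∀ p ∈ t, p ∉ K) ∧
      ∀ ζ, circleMean f ζ ≠ 0 → ∃ p ∈ t, ζ ∈ ball p 3 := by
    have htb : TotallyBounded {ζ | circleMean f ζ ≠ 0} :=
      (isCompact_closedBall (0 : ℂ) (R + 1)).totallyBounded.subset fun ζ hζ => by
        simpa using norm_le_of_circleMean_ne_zero hR hζ
    obtain ⟨t, hts, htf, htc⟩ := finite_approx_of_totallyBounded htb 1 one_pos
    choose! g hg using fun ζ (h : circleMean f ζ ≠ 0) =>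
      exists_notMem_of_circleMean_ne_zero hf hd h
    refine ⟨htf.toFinset.image g, fun p hp => ?_, fun ζ hζ => ?_⟩
    · obtain ⟨x, hx, rfl⟩ := Finset.mem_image.mp hp
      exact (hg x (hts (by simpa using hx))).1
    · obtain ⟨x, hx, hxζ⟩ := Set.mem_iUnion₂.mp (htc hζ)
      refine ⟨g x, Finset.mem_image_of_mem g (by simpa using hx), ?_⟩
      have h1 := (hg x (hts hx)).2
      rw [mem_ball] at *
      linarith [dist_triangle ζ x (g x)]
  obtain ⟨F, hF, hFz⟩ := exists_approx_cauchy_transform hK hc t ht1 (circleMean f)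
    hψ.measurable hψε (fun ζ hζ => norm_le_of_circleMean_ne_zero hR hζ) ht2
  refine ⟨(Real.pi⁻¹ : ℂ) • F, Subalgebra.smul_mem _ hF _, fun z => ?_⟩
  have h1 := hFz z
  rw [integral_circleMean_mul_inv hf hB hR] at h1
  have hI : ∫ ζ, ‖circleMean f ζ‖ * errKernel ‖(z : ℂ) - ζ‖ ≤ ε * ∫ w : ℂ, errKernel ‖w‖ := by
    rw [← integral_sub_left_eq_self (fun w : ℂ => errKernel ‖w‖) volume (z : ℂ),
      ← integral_const_mul]
    refine integral_mono (integrable_norm_mul_errKernel hψ.measurable hψε _)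
      ((integrable_errKernel_norm.comp_sub_left (z : ℂ)).const_mul ε) fun ζ => ?_
    refine mul_le_mul_of_nonneg_right (hψε ζ) ?_
    unfold errKernel
    positivity
  have hvol : volume.real (ball (z : ℂ) 1) = Real.pi := by
    simp [Measure.real, Complex.volume_ball]
  have h2 : ‖(∫ u in ball (z : ℂ) 1, f u) - Real.pi * f z‖ ≤ ε * Real.pi := by
    have e : (Real.pi : ℂ) * f z = ∫ u in ball (z : ℂ) 1, f z := by
      rw [setIntegral_const, hvol]; simp
    rw [e, ← integral_sub (hf.integrable_of_hasCompactSupport hcs).integrableOn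
      (integrableOn_const (by simp [Complex.volume_ball])), ← hvol]
    refine norm_setIntegral_le_of_norm_le_const (by simp [Complex.volume_ball]) fun u hu => ?_
    refine hε _ _ ?_
    rw [mem_ball, dist_eq_norm] at hu
    exact hu.le
  have hpi := Real.pi_pos
  have hpi' : (Real.pi : ℂ) ≠ 0 := by exact_mod_cast hpi.ne'
  have e : ((Real.pi⁻¹ : ℂ) • F) z - f z = (Real.pi⁻¹ : ℂ) *
      ((F z - ∫ u in ball (z : ℂ) 1, f u) + ((∫ u in ball (z : ℂ) 1, f u) - Real.pi * f z)) := by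
    rw [ContinuousMap.smul_apply, smul_eq_mul]
    field_simp
    ring
  rw [e, norm_mul, norm_inv, Complex.norm_real, Real.norm_of_nonneg hpi.le]
  calc _ ≤ Real.pi⁻¹ * (10 ^ 10 * (ε * ∫ w : ℂ, errKernel ‖w‖) + ε * Real.pi) := by
        gcongr
        exact (norm_add_le _ _).trans (add_le_add (h1.trans (by gcongr)) h2)
    _ = _ := by field_simp; ring

lemma exists_compactSupport_extension {K : Set ℂ} (hK : IsCompact K) {h : ℂ → ℂ}
    (hh : ContinuousOn h K) : ∃ f : ℂ → ℂ, Continuous f ∧ Set.EqOn f h K ∧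
      ∃ R, ∀ z, f z ≠ 0 → ‖z‖ ≤ R := by
  obtain ⟨g, hg⟩ := ContinuousMap.exists_restrict_eq hK.isClosed ⟨K.domRestrict h, hh.domRestrict⟩
  obtain ⟨R, hR⟩ := hK.isBounded.subset_closedBall 0
  obtain ⟨χ, h1, h0, -⟩ := exists_continuous_one_zero_of_isCompact hK
    (isOpen_ball (x := (0 : ℂ)) (ε := R + 1)).isClosed_compl
    (Set.disjoint_compl_right_iff_subset.mpr
      (hR.trans (closedBall_subset_ball (by linarith))))
  refine ⟨fun z => χ z * g z, by fun_prop, fun z hz => ?_, R + 1, fun z hz => ?_⟩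
  · have e := DFunLike.congr_fun hg ⟨z, hz⟩
    have e' : g z = h z := e
    simp [h1 hz, e']
  · by_contra! hlt
    have : χ z = 0 := h0 (by simpa using hlt.le)
    simp [this] at hz

/-- **Mergelyan's theorem**. -/
theorem exists_polynomial_norm_sub_lt {K : Set ℂ} (hK : IsCompact K) (hc : IsConnected Kᶜ)
    {h : ℂ → ℂ} (hh : ContinuousOn h K) (hd : DifferentiableOn ℂ h (interior K)) {ε : ℝ}
    (hε : 0 < ε) : ∃ p : ℂ[X], ∀ z ∈ K, ‖h z - p.eval z‖ < ε := by
  obtain ⟨f, hf, hfh, R, hR⟩ := exists_compactSupport_extension hK hh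
  set A : ℝ := 1 + Real.pi⁻¹ * (10 ^ 10 * ∫ w : ℂ, errKernel ‖w‖) with hA
  have hA0 : 0 < A := by
    have h1 : 0 ≤ ∫ w : ℂ, errKernel ‖w‖ := MeasureTheory.integral_nonneg fun w => by
      simp only [errKernel, Pi.zero_apply]
      positivity
    have := Real.pi_pos
    positivity
  have hcs : HasCompactSupport f := HasCompactSupport.of_support_subset_isCompact
    (isCompact_closedBall (0 : ℂ) R) fun z hz => by simpa using hR z hz
  have huc := hcs.uniformContinuous_of_continuous hf
  obtain ⟨δ', hδ', hδ⟩ := Metric.uniformContinuous_iff.mp huc (ε / 2 / A) (by positivity)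
  set δ : ℝ := δ' / 2 with hδe
  have hδ0 : 0 < δ := by positivity
  have hδc : (δ : ℂ) ≠ 0 := by exact_mod_cast hδ0.ne'
  set e := Homeomorph.mulLeft₀ (δ : ℂ) hδc with he
  have hez : ∀ z, e z = δ * z := fun z => rfl
  have hK' : IsCompact (e ⁻¹' K) := e.isCompact_preimage.mpr hK
  have hcK' : CompactSpace (e ⁻¹' K) := isCompact_iff_compactSpace.mp hK'
  have hc' : IsConnected (e ⁻¹' K)ᶜ := by
    rw [← Set.preimage_compl]; exact e.isConnected_preimage.mpr hc
  have hfd : DifferentiableOn ℂ (fun z => f (δ * z)) (interior (e ⁻¹' K)) := by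
    rw [← e.preimage_interior]
    have h1 : DifferentiableOn ℂ f (interior K) := hd.congr fun z hz => hfh (interior_subset hz)
    exact h1.comp (by fun_prop) fun z hz => hz
  obtain ⟨F, hF, hFz⟩ := exists_approx_of_oscillation_le hK' hc' (f := fun z => f (δ * z))
    (by fun_prop) (R := R / δ) (fun z hz => by
      have := hR _ hz
      rw [norm_mul, Complex.norm_real, Real.norm_of_nonneg hδ0.le] at this
      rw [le_div_iff₀ hδ0]; linarith) hfd (ε := ε / 2 / A) (fun x y hxy => by
      have := hδ (a := δ * x) (b := δ * y) (by
        rw [dist_eq_norm, ← mul_sub, norm_mul, Complex.norm_real, Real.norm_of_nonneg hδ0.le]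
        nlinarith)
      rw [dist_eq_norm] at this
      exact this.le)
  obtain ⟨p, hp⟩ := exists_polynomial_of_mem_polyClosure hF (half_pos hε)
  refine ⟨p.comp (C (δ : ℂ)⁻¹ * X), fun z hz => ?_⟩
  have hz' : (δ : ℂ)⁻¹ * z ∈ e ⁻¹' K := by
    rw [Set.mem_preimage, hez, mul_inv_cancel_left₀ hδc]; exact hz
  have h1 := hFz ⟨_, hz'⟩
  have h2 := hp ⟨_, hz'⟩
  simp only [mul_inv_cancel_left₀ hδc] at h1
  rw [div_mul_cancel₀ _ hA0.ne', hfh hz] at h1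
  rw [eval_comp, eval_mul, eval_C, eval_X]
  calc _ = ‖(F ⟨_, hz'⟩ - p.eval ((δ : ℂ)⁻¹ * z)) - (F ⟨_, hz'⟩ - h z)‖ := by congr 1; ring
    _ < ε := (norm_sub_le _ _).trans_lt (by linarith)

lemma isPreconnected_setOf_norm_sub_mem (c : ℂ) {S : Set ℝ} (hS : IsPreconnected S)
    (h0 : ∀ r ∈ S, 0 ≤ r) :
    IsPreconnected {z : ℂ | ‖z - c‖ ∈ S} := by
  have h : {z : ℂ | ‖z - c‖ ∈ S} = (fun x : ℝ × ℝ => c + x.1 * Complex.exp (x.2 * Complex.I)) ''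
      (S ×ˢ Set.univ) := by
    ext z
    constructor
    · intro hz
      refine ⟨(‖z - c‖, (z - c).arg), ⟨hz, trivial⟩, ?_⟩
      simp [Complex.norm_mul_exp_arg_mul_I]
    · rintro ⟨⟨r, θ⟩, ⟨hr, -⟩, rfl⟩
      simp [abs_of_nonneg (h0 r hr), hr]
  rw [h]
  exact (hS.prod isPreconnected_univ).image _ (by fun_prop)

lemma IsPreconnected.diff_of_diff {U D B : Set ℂ} (hU : IsPreconnected U) (hUo : IsOpen U)
    (hD : IsClosed D) (hDB : D ⊆ B) (hBU : B ⊆ U) (hB : IsOpen B) (hBD : IsPreconnected (B \ D))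
    (hne : (B \ D).Nonempty) : IsPreconnected (U \ D) := by
  have key : ∀ u v : Set ℂ, IsOpen u → IsOpen v → U \ D ⊆ u ∪ v → (U \ D) ∩ (u ∩ v) = ∅ →
      B \ D ⊆ u → U \ D ⊆ u := by
    intro u v hu hv huv hd hBu
    have hdisj : Disjoint ((U \ D) ∩ u ∪ B) ((U \ D) ∩ v) := by
      rw [Set.disjoint_left]
      rintro x (⟨hx, hxu⟩ | hxB) ⟨hx', hxv⟩
      · exact (hd.subset ⟨hx, hxu, hxv⟩ : x ∈ (∅ : Set ℂ))
      · exact (hd.subset ⟨hx', hBu ⟨hxB, hx'.2⟩, hxv⟩ : x ∈ (∅ : Set ℂ))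
    have hUD := hUo.sdiff hD
    have hcov : U ⊆ ((U \ D) ∩ u ∪ B) ∪ ((U \ D) ∩ v) := fun x hx => by
      by_cases hxD : x ∈ D
      · exact Or.inl (Or.inr (hDB hxD))
      · rcases huv ⟨hx, hxD⟩ with h | h
        · exact Or.inl (Or.inl ⟨⟨hx, hxD⟩, h⟩)
        · exact Or.inr ⟨⟨hx, hxD⟩, h⟩
    obtain ⟨y, hy⟩ := hne
    have := hU.subset_left_of_subset_union ((hUD.inter hu).union hB) (hUD.inter hv) hdisj hcov
      ⟨y, hBU hy.1, Or.inr hy.1⟩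
    intro x hx
    rcases this hx.1 with h | h
    · exact h.2
    · exact hBu ⟨h, hx.2⟩
  rw [isPreconnected_iff_subset_of_disjoint]
  intro u v hu hv huv hd
  have hBD' := Set.sdiff_subset_sdiff_left (t := D) hBU
  rcases isPreconnected_iff_subset_of_disjoint.mp hBD u v hu hv (hBD'.trans huv)
    (Set.subset_empty_iff.mp (hd ▸ Set.inter_subset_inter_left _ hBD')) with h | h
  · exact Or.inl (key u v hu hv huv hd h)
  · exact Or.inr (key v u hv hu (Set.union_comm u v ▸ huv) (Set.inter_comm u v ▸ hd) h)

lemma isConnected_compl_union_singleton {K : Set ℂ} (hK : IsCompact K) (hc : IsConnected Kᶜ)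
    {a : ℂ} (ha : a ∉ K) : IsConnected (K ∪ {a})ᶜ := by
  obtain ⟨ε, hε, hb⟩ := Metric.isOpen_iff.mp hK.isClosed.isOpen_compl a ha
  have hBD : ball a ε \ {a} = {z : ℂ | ‖z - a‖ ∈ Set.Ioo 0 ε} := by
    ext z
    simp [dist_eq_norm, sub_eq_zero, and_comm]
  have hne : (ball a ε \ {a}).Nonempty := by
    refine ⟨a + (ε / 2 : ℝ), ?_⟩
    rw [hBD]
    simp only [Set.mem_ofPred_eq, add_sub_cancel_left, Complex.norm_real, Set.mem_Ioo]
    rw [Real.norm_of_nonneg (by positivity)]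
    constructor <;> linarith
  rw [Set.compl_union, ← Set.sdiff_eq]
  refine ⟨hne.mono (Set.sdiff_subset_sdiff_left hb), ?_⟩
  exact hc.isPreconnected.diff_of_diff hK.isClosed.isOpen_compl isClosed_singleton
    (by simpa using hε) hb isOpen_ball
    (hBD ▸ isPreconnected_setOf_norm_sub_mem a isPreconnected_Ioo fun r hr => hr.1.le) hne

lemma isConnected_compl_union_closedBall {K : Set ℂ} (hK : IsCompact K) (hc : IsConnected Kᶜ)
    (hd : Disjoint K unitD) {r : ℝ} (hr0 : 0 ≤ r) (hr : r < 1) :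
    IsConnected (K ∪ closedBall 0 r)ᶜ := by
  have hBD : ball (0 : ℂ) 1 \ closedBall 0 r = {z : ℂ | ‖z - 0‖ ∈ Set.Ioo r 1} := by
    ext z
    simp [and_comm]
  have hb : ball (0 : ℂ) 1 ⊆ Kᶜ := hd.subset_compl_left
  have hne : (ball (0 : ℂ) 1 \ closedBall 0 r).Nonempty := by
    refine ⟨((r + 1) / 2 : ℝ), ?_⟩
    rw [hBD]
    simp only [Set.mem_ofPred_eq, sub_zero, Complex.norm_real, Set.mem_Ioo]
    rw [Real.norm_of_nonneg (by positivity)]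
    constructor <;> linarith
  rw [Set.compl_union, ← Set.sdiff_eq]
  refine ⟨hne.mono (Set.sdiff_subset_sdiff_left hb), ?_⟩
  exact hc.isPreconnected.diff_of_diff hK.isClosed.isOpen_compl isClosed_closedBall
    (closedBall_subset_ball hr) hb isOpen_ball
    (hBD ▸ isPreconnected_setOf_norm_sub_mem 0 isPreconnected_Ioo
      fun s hs => hr0.trans hs.1.le) hne

/-- The union of the unit disc, the complement of a closed disc centred at the origin and finitely
many discs from a countable basis of the topology of `ℂ`. -/
def codedOpen (x : ℕ × Finset (ℕ × ℕ)) : Set ℂ :=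
  unitD ∪ {z | ‖z - 0‖ ∈ Set.Ioi (x.1 : ℝ)} ∪
    ⋃ y ∈ x.2, ball (TopologicalSpace.denseSeq ℂ y.1) (1 / ((y.2 : ℝ) + 1))

lemma isOpen_codedOpen (x : ℕ × Finset (ℕ × ℕ)) : IsOpen (codedOpen x) :=
  (isOpen_ball.union (isOpen_Ioi.preimage (by fun_prop))).union
    (isOpen_biUnion fun _ _ => isOpen_ball)

lemma exists_codedOpen {K : Set ℂ} (hK : IsCompact K) (hc : IsConnected Kᶜ)
    (hd : Disjoint K unitD) : ∃ x, IsConnected (codedOpen x) ∧ K ⊆ (codedOpen x)ᶜ := by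
  obtain ⟨R, hR⟩ := hK.isBounded.subset_closedBall 0
  obtain ⟨N, hN⟩ := exists_nat_ge R
  have hKN : ∀ z ∈ K, ‖z‖ ≤ N := fun z hz => by
    have := hR hz
    rw [mem_closedBall_zero_iff] at this
    exact this.trans hN
  have hKo := hK.isClosed.isOpen_compl
  have h0 : (0 : ℂ) ∈ Kᶜ := hd.subset_compl_left (mem_ball_self one_pos)
  have hw : ((N + 1 : ℝ) : ℂ) ∈ Kᶜ := fun h => by
    have := hKN _ h
    rw [Complex.norm_real, Real.norm_of_nonneg (by positivity)] at this
    linarith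
  obtain ⟨γ, hγ⟩ := ((hKo.isConnected_iff_isPathConnected).mp hc).joinedIn 0 h0 _ hw
  have hγc : IsCompact (Set.range γ) := isCompact_range γ.continuous
  have hγp : IsPreconnected (Set.range γ) := isPreconnected_range γ.continuous
  have h0γ : (0 : ℂ) ∈ Set.range γ := ⟨0, γ.source⟩
  have hwγ : ((N + 1 : ℝ) : ℂ) ∈ Set.range γ := ⟨1, γ.target⟩
  have hex : ∀ z ∈ Set.range γ, ∃ y : ℕ × ℕ,
      z ∈ ball (TopologicalSpace.denseSeq ℂ y.1) (1 / ((y.2 : ℝ) + 1)) ∧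
      ball (TopologicalSpace.denseSeq ℂ y.1) (1 / ((y.2 : ℝ) + 1)) ⊆ Kᶜ := by
    rintro _ ⟨s, rfl⟩
    obtain ⟨ε, hε, hb⟩ := Metric.isOpen_iff.mp hKo _ (hγ s)
    obtain ⟨n, hn⟩ := exists_nat_one_div_lt (half_pos hε)
    obtain ⟨i, hi⟩ := (TopologicalSpace.denseRange_denseSeq ℂ).exists_dist_lt (γ s)
      (show 0 < 1 / ((n : ℝ) + 1) by positivity)
    refine ⟨(i, n), hi, (ball_subset_ball' ?_).trans hb⟩
    rw [dist_comm]
    dsimp only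
    linarith
  choose! c hc1 hc2 using hex
  obtain ⟨t, ht, hcov⟩ := hγc.elim_nhds_subcover
    (fun z => ball (TopologicalSpace.denseSeq ℂ (c z).1) (1 / (((c z).2 : ℝ) + 1)))
    fun z hz => isOpen_ball.mem_nhds (hc1 z hz)
  have hsub : Set.range γ ⊆ codedOpen (N, t.image c) := fun z hz => by
    obtain ⟨y, hy, hzy⟩ := Set.mem_iUnion₂.mp (hcov hz)
    exact Or.inr (Set.mem_iUnion₂.mpr ⟨c y, Finset.mem_image_of_mem c hy, hzy⟩)
  refine ⟨(N, t.image c), ⟨⟨0, hsub h0γ⟩, ?_⟩, ?_⟩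
  · refine isPreconnected_of_forall 0 ?_
    have key : ∀ s : Set ℂ, IsPreconnected s → s ⊆ codedOpen (N, t.image c) →
        (Set.range γ ∩ s).Nonempty → ∀ y ∈ s, ∃ t' ⊆ codedOpen (N, t.image c),
          (0 : ℂ) ∈ t' ∧ y ∈ t' ∧ IsPreconnected t' := fun s hs hss hne y hy =>
      ⟨Set.range γ ∪ s, Set.union_subset hsub hss, Or.inl h0γ, Or.inr hy, hγp.union' hne hs⟩
    rintro y ((hy | hy) | hy)
    · exact key unitD isPreconnected_ball (fun _ h => Or.inl (Or.inl h))
        ⟨0, h0γ, mem_ball_self one_pos⟩ y hy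
    · refine key {z | ‖z - 0‖ ∈ Set.Ioi (N : ℝ)} (isPreconnected_setOf_norm_sub_mem 0
        isPreconnected_Ioi fun r hr => (Nat.cast_nonneg N).trans (le_of_lt hr))
        (fun _ h => Or.inl (Or.inr h)) ⟨_, hwγ, ?_⟩ y hy
      rw [Set.mem_ofPred_eq, sub_zero, Complex.norm_real, Real.norm_of_nonneg (by positivity)]
      simp
    · obtain ⟨x, hx, hyx⟩ := Set.mem_iUnion₂.mp hy
      obtain ⟨z, hz, rfl⟩ := Finset.mem_image.mp hx
      exact key _ isPreconnected_ball
        (fun w hw => Or.inr (Set.mem_iUnion₂.mpr ⟨c z, hx, hw⟩)) ⟨z, ht z hz, hc1 z (ht z hz)⟩ y hyx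
  · rw [Set.subset_compl_comm]
    rintro y ((hy | hy) | hy) hyK
    · exact Set.disjoint_left.mp hd hyK hy
    · have := hKN y hyK
      rw [Set.mem_ofPred_eq, sub_zero, Set.mem_Ioi] at hy
      linarith
    · obtain ⟨x, hx, hyx⟩ := Set.mem_iUnion₂.mp hy
      obtain ⟨z, hz, rfl⟩ := Finset.mem_image.mp hx
      exact hc2 z (ht z hz) hyx hyK

lemma exists_exhausting_compacts : ∃ C : ℕ → Set ℂ, (∀ m, IsCompact (C m)) ∧
    (∀ m, Disjoint (C m) unitD) ∧ (∀ m, IsConnected (C m)ᶜ) ∧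
    ∀ K, IsCompact K → IsConnected Kᶜ → Disjoint K unitD → ∃ m, K ⊆ C m := by
  classical
  obtain ⟨e, he⟩ := exists_surjective_nat (ℕ × Finset (ℕ × ℕ))
  refine ⟨fun m => if IsConnected (codedOpen (e m)) then (codedOpen (e m))ᶜ else ∅,
    fun m => ?_, fun m => ?_, fun m => ?_, fun K hK hc hd => ?_⟩
  · dsimp only
    split_ifs
    · refine (isCompact_closedBall (0 : ℂ) (e m).1).of_isClosed_subset
        (isOpen_codedOpen _).isClosed_compl fun z hz => ?_
      by_contra h
      refine hz (Or.inl (Or.inr ?_))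
      simpa using h
    · exact isCompact_empty
  · dsimp only
    split_ifs
    · exact Set.disjoint_compl_left_iff_subset.mpr fun z hz => Or.inl (Or.inl hz)
    · exact Set.empty_disjoint _
  · dsimp only
    split_ifs with h
    · rwa [compl_compl]
    · rw [Set.compl_empty]; exact isConnected_univ
  · obtain ⟨x, hx, hKx⟩ := exists_codedOpen hK hc hd
    obtain ⟨m, rfl⟩ := he x
    exact ⟨m, by simpa only [if_pos hx] using hKx⟩

lemma tc_eval (p : ℂ[X]) (k : ℕ) : tc (fun z => p.eval z) k = p.coeff k := by
  have h : ∀ k, iteratedDeriv k (fun z => p.eval z) = fun z => (derivative^[k] p).eval z := by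
    intro k
    induction k with
    | zero => simp
    | succ k ih =>
      rw [iteratedDeriv_succ, ih]
      ext z
      rw [Polynomial.deriv, Function.iterate_succ_apply']
  rw [tc, h]
  dsimp only
  rw [← coeff_zero_eq_eval_zero, coeff_iterate_derivative, zero_add, Nat.descFactorial_self,
    nsmul_eq_mul, mul_div_cancel_left₀ _ (by exact_mod_cast k.factorial_ne_zero)]

lemma tc_eval_mul (Q : ℂ[X]) {f : ℂ → ℂ} (hf : DifferentiableOn ℂ f unitD) (j : ℕ) :
    tc (fun z => Q.eval z * f z) j = ∑ i ∈ range (j + 1), Q.coeff i * tc f (j - i) := by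
  have hfa : AnalyticAt ℂ f 0 :=
    hf.analyticAt (isOpen_ball.mem_nhds (mem_ball_self one_pos))
  have h := iteratedDeriv_mul (n := j) (x := (0 : ℂ)) (f := fun z => Q.eval z) (g := f)
    (Q.differentiable.contDiff.contDiffAt) hfa.contDiffAt
  rw [tc, show (fun z => Q.eval z * f z) = (fun z => Q.eval z) * f from rfl, h, Finset.sum_div]
  refine Finset.sum_congr rfl fun i hi => ?_
  have hij : i ≤ j := Nat.lt_succ_iff.mp (Finset.mem_range.mp hi)
  rw [← tc_eval Q i, tc, tc]
  have h1 := j.factorial_ne_zero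
  have h2 := i.factorial_ne_zero
  have h3 := (j - i).factorial_ne_zero
  have h4 : ((j.choose i : ℕ) : ℂ) * i.factorial * (j - i).factorial = j.factorial := by
    exact_mod_cast Nat.choose_mul_factorial_mul_factorial hij
  have h1' : (j.factorial : ℂ) ≠ 0 := by exact_mod_cast h1
  have h2' : (i.factorial : ℂ) ≠ 0 := by exact_mod_cast h2
  have h3' : ((j - i).factorial : ℂ) ≠ 0 := by exact_mod_cast h3
  rw [← h4] at h1' ⊢
  have h5 := left_ne_zero_of_mul (left_ne_zero_of_mul h1')
  field_simp

lemma hankelDet_ne_zero_of_isPade {s : ℕ → ℂ} {m n : ℕ} {P Q : ℂ[X]} (h : IsPade s m n P Q)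
    (hQ : Q.degree = n) : hankelDet s m n ≠ 0 := by
  intro hdet
  obtain ⟨v, hv0, hv⟩ := Matrix.exists_mulVec_eq_zero_iff.mpr hdet
  obtain ⟨hPm, -, hPQ, -, hj⟩ := h
  set S : PowerSeries ℂ := PowerSeries.mk s with hS
  set V : ℂ[X] := ∑ j : Fin n, C (v j.rev) * X ^ (j : ℕ) with hV
  have hVdeg : V.degree < n := degree_sum_fin_lt fun j : Fin n => v j.rev
  have hVcoe : (V : PowerSeries ℂ) =
      ∑ j : Fin n, PowerSeries.C (v j.rev) * PowerSeries.X ^ (j : ℕ) := by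
    rw [hV, ← coeToPowerSeries.ringHom_apply, map_sum]
    simp
  set U : ℂ[X] := PowerSeries.trunc m ((V : PowerSeries ℂ) * S) with hU
  have hUdeg : U.degree < m := PowerSeries.degree_trunc_lt _ _
  have hcoef : ∀ i : Fin n, PowerSeries.coeff (m + i) ((V : PowerSeries ℂ) * S) = 0 := fun i => by
    refine Eq.trans ?_ (congrFun hv i)
    rw [hVcoe, Finset.sum_mul, map_sum, Matrix.mulVec, dotProduct, ← Equiv.sum_comp Fin.revPerm]
    refine Finset.sum_congr rfl fun j _ => ?_
    rw [mul_assoc, PowerSeries.coeff_C_mul, PowerSeries.coeff_X_pow_mul', Matrix.of_apply,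
      Fin.revPerm_apply, Fin.rev_rev, Fin.val_rev, mul_comm]
    congr 1
    have hjn := j.isLt
    rw [acoefZ]
    by_cases hle : n - ((j : ℕ) + 1) ≤ m + i
    · rw [if_pos hle, if_pos (by omega), hS, PowerSeries.coeff_mk]
      congr 1
      omega
    · rw [if_neg hle, if_neg (by omega)]
  have hUV : (PowerSeries.X : PowerSeries ℂ) ^ (m + n) ∣ (V : PowerSeries ℂ) * S - U := by
    rw [PowerSeries.X_pow_dvd_iff]
    intro k hk
    rw [map_sub, coeff_coe, hU, PowerSeries.coeff_trunc]
    split_ifs with h1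
    · rw [sub_self]
    · have := hcoef ⟨k - m, by omega⟩
      rw [sub_zero, ← this]
      congr 2
      dsimp only
      omega
  have hQP : (PowerSeries.X : PowerSeries ℂ) ^ (m + n) ∣ (Q : PowerSeries ℂ) * S - P := by
    rw [PowerSeries.X_pow_dvd_iff]
    intro k hk
    rw [map_sub, coeff_coe, ← hj k hk.le, PowerSeries.coeff_mul,
      Finset.Nat.sum_antidiagonal_eq_sum_range_succ
        (fun i j => PowerSeries.coeff i (Q : PowerSeries ℂ) * PowerSeries.coeff j S)]
    simp [hS]
  have hdvd : (PowerSeries.X : PowerSeries ℂ) ^ (m + n) ∣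
      ((V * P - Q * U : ℂ[X]) : PowerSeries ℂ) := by
    have := (hUV.mul_left (Q : PowerSeries ℂ)).sub (hQP.mul_left (V : PowerSeries ℂ))
    convert this using 1
    push_cast
    ring
  have hVPd : (V * P).degree < ((m + n : ℕ) : WithBot ℕ) := by
    by_cases hP0 : P = 0
    · rw [hP0, mul_zero, degree_zero]; exact WithBot.bot_lt_coe _
    · rw [degree_mul, add_comm, Nat.cast_add]
      exact WithBot.add_lt_add_of_le_of_lt (by simpa using hP0)
        (degree_le_of_natDegree_le hPm) hVdeg
  have hQUd : (Q * U).degree < ((m + n : ℕ) : WithBot ℕ) := by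
    rw [degree_mul, hQ, add_comm m n, Nat.cast_add]
    exact WithBot.add_lt_add_of_le_of_lt (by simp) le_rfl hUdeg
  have hzero : V * P - Q * U = 0 := by
    ext k
    rw [coeff_zero]
    by_cases hk : k < m + n
    · rw [← coeff_coe]
      exact PowerSeries.X_pow_dvd_iff.mp hdvd k hk
    · refine coeff_eq_zero_of_degree_lt
        (((degree_sub_le _ _).trans_lt (max_lt hVPd hQUd)).trans_le ?_)
      exact_mod_cast not_lt.mp hk
  have hQV : Q ∣ V := hPQ.symm.dvd_of_dvd_mul_right ⟨U, sub_eq_zero.mp hzero⟩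
  have hV0 : V = 0 := eq_zero_of_dvd_of_degree_lt hQV (hQ ▸ hVdeg)
  refine hv0 (funext fun j => ?_)
  have := congrArg (fun p : ℂ[X] => p.coeff (j.rev : ℕ)) hV0
  simpa only [hV, finsetSum_coeff, coeff_C_mul_X_pow, Fin.val_inj, Finset.sum_ite_eq,
    Finset.mem_univ, if_true, Fin.rev_rev, coeff_zero, Pi.zero_apply] using this

/-- The Taylor polynomial of degree at most `N` at the origin. -/
def taylorPoly (g : ℂ → ℂ) (N : ℕ) : ℂ[X] := ∑ k ∈ range (N + 1), C (tc g k) * X ^ k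

lemma coeff_taylorPoly (g : ℂ → ℂ) (N k : ℕ) :
    (taylorPoly g N).coeff k = if k ≤ N then tc g k else 0 := by
  simp [taylorPoly]

lemma eval_taylorPoly (g : ℂ → ℂ) (N : ℕ) (z : ℂ) :
    (taylorPoly g N).eval z = ∑ k ∈ range (N + 1), tc g k * z ^ k := by
  simp [taylorPoly, eval_finsetSum]

lemma one_sub_C_inv_mul_X {a : ℂ} (ha : a ≠ 0) :
    (1 - C a⁻¹ * X : ℂ[X]) = C (-a⁻¹) * (X - C a) := by
  rw [mul_sub, ← C_mul, neg_mul, inv_mul_cancel₀ ha]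
  simp
  ring

lemma degree_one_sub_C_inv_mul_X_pow {a : ℂ} (ha : a ≠ 0) (q : ℕ) :
    ((1 - C a⁻¹ * X : ℂ[X]) ^ q).degree = q := by
  rw [one_sub_C_inv_mul_X ha, degree_pow, degree_C_mul (by simpa using ha), degree_X_sub_C]
  simp

lemma isCoprime_one_sub_C_inv_mul_X_pow {a : ℂ} (ha : a ≠ 0) (q : ℕ) {P : ℂ[X]}
    (hP : P.eval a ≠ 0) : IsCoprime P ((1 - C a⁻¹ * X) ^ q) := by
  refine IsCoprime.pow_right ?_
  rw [one_sub_C_inv_mul_X ha, isCoprime_mul_unit_left_right (by simpa using ha)]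
  refine IsCoprime.symm ?_
  rw [(irreducible_X_sub_C a).coprime_iff_not_dvd, dvd_iff_isRoot]
  exact hP

lemma mem_Nset_and_isPade {f : ℂ → ℂ} (hf : DifferentiableOn ℂ f unitD) {a : ℂ} (ha : a ≠ 0)
    {q l : ℕ} {g : ℂ → ℂ} (hg : g = fun z => ((1 - C a⁻¹ * X : ℂ[X]) ^ q).eval z * f z)
    (hgap : ∀ j, l < j → j ≤ l + q → tc g j = 0) (hP : (taylorPoly g l).eval a ≠ 0) :
    tc f ∈ Nset l q ∧ IsPade (tc f) l q (taylorPoly g l) ((1 - C a⁻¹ * X) ^ q) := by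
  have hdeg := degree_one_sub_C_inv_mul_X_pow ha q
  have h : IsPade (tc f) l q (taylorPoly g l) ((1 - C a⁻¹ * X) ^ q) := by
    refine ⟨natDegree_sum_le_of_forall_le _ _ fun k hk => ?_,
      (natDegree_eq_of_degree_eq_some hdeg).le, isCoprime_one_sub_C_inv_mul_X_pow ha q hP, ?_,
      fun j hj => ?_⟩
    · exact (natDegree_C_mul_X_pow_le _ _).trans (Nat.lt_succ_iff.mp (Finset.mem_range.mp hk))
    · simp [coeff_zero_eq_eval_zero]
    · rw [← tc_eval_mul _ hf, coeff_taylorPoly, ← hg]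
      split_ifs with h1
      · rfl
      · exact hgap j (not_le.mp h1) hj
  exact ⟨⟨hankelDet_ne_zero_of_isPade h hdeg, _, _, h, hdeg⟩, h⟩

lemma exists_block {K : Set ℂ} (hK : IsCompact K) (hc : IsConnected Kᶜ) (hd : Disjoint K unitD)
    {r : ℝ} (hr0 : 0 ≤ r) (hr : r < 1) {η : ℝ} (hη : 0 < η) (N : ℕ) (p t : ℂ[X]) :
    ∃ R : ℂ[X], (∀ z ∈ closedBall (0 : ℂ) r, ‖(X ^ N * R).eval z‖ ≤ η) ∧
      ∀ z ∈ K, ‖(p + X ^ N * R).eval z - t.eval z‖ ≤ η := by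
  classical
  set D : Set ℂ := closedBall 0 r with hD
  have hDK : Disjoint K D := hd.mono_right (closedBall_subset_ball hr)
  set h : ℂ → ℂ := fun z => if z ∈ D then 0 else (t - p).eval z / z ^ N with hh
  have h0D : (0 : ℂ) ∈ D := mem_closedBall_self hr0
  have hdiff : ∀ z ∈ K, DifferentiableAt ℂ h z := fun z hz => by
    have hzD : z ∉ D := Set.disjoint_left.mp hDK hz
    have hz0 : z ≠ 0 := fun e => hzD (e ▸ h0D)
    have hev : h =ᶠ[𝓝 z] fun z => (t - p).eval z / z ^ N := by
      filter_upwards [isClosed_closedBall.isOpen_compl.mem_nhds hzD] with w hw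
      exact if_neg hw
    refine hev.differentiableAt_iff.mpr ?_
    exact (t - p).differentiableAt.div (by fun_prop) (pow_ne_zero _ hz0)
  have hzero : ∀ z ∈ D, h =ᶠ[𝓝[K ∪ D] z] fun _ => 0 := fun z hz => by
    filter_upwards [self_mem_nhdsWithin, mem_nhdsWithin_of_mem_nhds
      (hK.isClosed.isOpen_compl.mem_nhds (Set.disjoint_right.mp hDK hz))] with w hw hwK
    exact if_pos (hw.resolve_left hwK)
  have hcont : ContinuousOn h (K ∪ D) := by
    rintro z (hz | hz)
    · exact (hdiff z hz).continuousAt.continuousWithinAt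
    · exact continuousWithinAt_const.congr_of_eventuallyEq (hzero z hz) (if_pos hz)
  have hdif : DifferentiableOn ℂ h (interior (K ∪ D)) := by
    intro z hz
    rcases interior_subset hz with hzK | hzD
    · exact (hdiff z hzK).differentiableWithinAt
    · exact (differentiableWithinAt_const 0).congr_of_eventuallyEq
        ((hzero z hzD).filter_mono (nhdsWithin_mono _ interior_subset)) (if_pos hzD)
  obtain ⟨B, hB⟩ := hK.isBounded.subset_closedBall 0
  set M : ℝ := max B 1 with hM
  have hM1 : 1 ≤ M := le_max_right _ _
  obtain ⟨R, hR⟩ := exists_polynomial_norm_sub_lt (hK.union (isCompact_closedBall 0 r))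
    (isConnected_compl_union_closedBall hK hc hd hr0 hr) hcont hdif
    (show 0 < η / M ^ N by positivity)
  have hle : η / M ^ N ≤ η := div_le_self hη.le (one_le_pow₀ hM1)
  refine ⟨R, fun z hz => ?_, fun z hz => ?_⟩
  · have h1 := hR z (Or.inr hz)
    rw [show h z = 0 from if_pos hz, zero_sub, norm_neg] at h1
    rw [eval_mul, eval_pow, eval_X, norm_mul, norm_pow]
    have hz1 : ‖z‖ ≤ 1 := (mem_closedBall_zero_iff.mp hz).trans hr.le
    calc ‖z‖ ^ N * ‖R.eval z‖ ≤ 1 * ‖R.eval z‖ := by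
          gcongr; exact pow_le_one₀ (norm_nonneg _) hz1
      _ ≤ η := by linarith
  · have h1 := hR z (Or.inl hz)
    have hzD : z ∉ D := Set.disjoint_left.mp hDK hz
    have hz0 : z ≠ 0 := fun e => hzD (e ▸ h0D)
    rw [show h z = (t - p).eval z / z ^ N from if_neg hzD] at h1
    have e : (p + X ^ N * R).eval z - t.eval z =
        -(z ^ N * ((t - p).eval z / z ^ N - R.eval z)) := by
      rw [mul_sub, mul_div_cancel₀ _ (pow_ne_zero _ hz0)]
      simp
      ring
    have hzM : ‖z‖ ≤ M := (mem_closedBall_zero_iff.mp (hB hz)).trans (le_max_left _ _)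
    rw [e, norm_neg, norm_mul, norm_pow]
    calc _ ≤ M ^ N * (η / M ^ N) := by gcongr
      _ = η := by field_simp

lemma exists_gt_and_le {μ : ℕ → ℕ} (hμ : ∀ N : ℕ, ∃ k, N < μ k) (κ M : ℕ) :
    ∃ κ', κ < κ' ∧ M ≤ μ κ' := by
  obtain ⟨k, hk⟩ := hμ (M + ∑ i ∈ range (κ + 1), μ i)
  refine ⟨k, ?_, by omega⟩
  by_contra! hle
  have := Finset.single_le_sum (f := μ) (fun i _ => Nat.zero_le _)
    (Finset.mem_range.mpr (show k < κ + 1 by omega))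
  omega

/-- One stage of the inductive construction: from polynomials `p`, an index `κ` and a degree `d`,
stage `s` produces `p'`, `κ'` and `d'`. -/
def IsStage (μ : ℕ → ℕ) (q : ℕ) (K : Set ℂ) (k : ℕ) (φ : ℂ[X]) (s : ℕ)
    (x y : (ℕ → ℂ[X]) × ℕ × ℕ) : Prop :=
  x.2.2 < y.2.2 ∧ y.2.1 = μ y.2.2 + q + 1 ∧ (∀ j ≤ s, (y.1 j).natDegree ≤ μ y.2.2) ∧
  (∀ j, s < j → y.1 j = x.1 j) ∧
  (∀ j, ∃ R : ℂ[X], y.1 j = x.1 j + (if j = s then X ^ x.2.1 else 0) + X ^ (x.2.1 + 1) * R ∧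
    ∀ z ∈ closedBall (0 : ℂ) (1 - 1 / ((s : ℝ) + 2)),
      ‖(X ^ (x.2.1 + 1) * R).eval z‖ ≤ (1 / 2) ^ s) ∧
  ∀ j ≤ s, ∀ z ∈ K, ‖(y.1 j).eval z - (if j = k then φ else 0).eval z‖ ≤
    (1 / 2) ^ (x.2.1 + s) / (s + 1)

lemma exists_isStage {μ : ℕ → ℕ} (hμ : ∀ N : ℕ, ∃ k, N < μ k) (q : ℕ) {K : Set ℂ}
    (hK : IsCompact K) (hc : IsConnected Kᶜ) (hd : Disjoint K unitD) (k : ℕ) (φ : ℂ[X]) (s : ℕ)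
    (x : (ℕ → ℂ[X]) × ℕ × ℕ) : ∃ y, IsStage μ q K k φ s x y := by
  classical
  have hr : 1 / ((s : ℝ) + 2) ≤ 1 := by
    rw [div_le_one (by positivity)]; linarith [(Nat.cast_nonneg s : (0 : ℝ) ≤ s)]
  have hη : (1 / 2 : ℝ) ^ (x.2.1 + s) / (s + 1) ≤ (1 / 2) ^ s := by
    refine (div_le_self (by positivity) (by linarith [(Nat.cast_nonneg s : (0 : ℝ) ≤ s)])).trans ?_
    exact pow_le_pow_of_le_one (by norm_num) (by norm_num) (by omega)
  choose R hR1 hR2 using fun j : ℕ => exists_block hK hc hd (r := 1 - 1 / ((s : ℝ) + 2))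
    (by linarith) (by linarith [show 0 < 1 / ((s : ℝ) + 2) by positivity])
    (η := (1 / 2) ^ (x.2.1 + s) / (s + 1)) (by positivity) (x.2.1 + 1)
    (x.1 j + if j = s then X ^ x.2.1 else 0) (if j = k then φ else 0)
  set p : ℕ → ℂ[X] := fun j => if j ≤ s then
    x.1 j + (if j = s then X ^ x.2.1 else 0) + X ^ (x.2.1 + 1) * R j else x.1 j with hp
  obtain ⟨κ, hκ, hM⟩ := exists_gt_and_le hμ x.2.2 (∑ j ∈ range (s + 1), (p j).natDegree)
  refine ⟨(p, μ κ + q + 1, κ), hκ, rfl, fun j hj => ?_, fun j hj => ?_, fun j => ?_,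
    fun j hj z hz => ?_⟩
  · exact (Finset.single_le_sum (f := fun j => (p j).natDegree) (fun i _ => Nat.zero_le _)
      (Finset.mem_range.mpr (Nat.lt_succ_of_le hj))).trans hM
  · exact if_neg (not_le.mpr hj)
  · by_cases hj : j ≤ s
    · exact ⟨R j, if_pos hj, fun z hz => (hR1 j z hz).trans hη⟩
    · refine ⟨0, ?_, fun z _ => by simp⟩
      simp [hp, hj, (not_le.mp hj).ne']
  · have : p j = _ := if_pos hj
    dsimp only
    rw [this]
    exact hR2 j z hz

lemma exists_stages {μ : ℕ → ℕ} (hμ : ∀ N : ℕ, ∃ k, N < μ k) (q : ℕ) {K : ℕ → Set ℂ}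
    (hK : ∀ s, IsCompact (K s)) (hc : ∀ s, IsConnected (K s)ᶜ) (hd : ∀ s, Disjoint (K s) unitD)
    (k : ℕ → ℕ) (φ : ℕ → ℂ[X]) : ∃ x : ℕ → (ℕ → ℂ[X]) × ℕ × ℕ, x 0 = (0, 1, 0) ∧
      ∀ s, IsStage μ q (K s) (k s) (φ s) s (x s) (x (s + 1)) := by
  choose f hf using fun s x => exists_isStage hμ q (hK s) (hc s) (hd s) (k s) (φ s) s x
  exact ⟨fun s => Nat.rec (0, 1, 0) f s, rfl, fun s => hf s _⟩

lemma sphere_half_subset : sphere (0 : ℂ) (1 / 2) ⊆ unitD := fun z hz => by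
  rw [mem_sphere_zero_iff_norm] at hz
  rw [unitD, mem_ball_zero_iff, hz]
  norm_num

lemma norm_tc_le {f : ℂ → ℂ} (hf : DifferentiableOn ℂ f unitD) {M : ℝ}
    (hM : ∀ z ∈ sphere (0 : ℂ) (1 / 2), ‖f z‖ ≤ M) (n : ℕ) : ‖tc f n‖ ≤ M * 2 ^ n := by
  have h := Complex.norm_iteratedDeriv_le_of_forall_mem_sphere_norm_le n
    (show (0 : ℝ) < 1 / 2 by norm_num)
    ((hf.mono (closedBall_subset_ball (by norm_num))).diffContOnCl_ball le_rfl) hM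
  have hn : (0 : ℝ) < n.factorial := by exact_mod_cast n.factorial_pos
  rw [tc, norm_div, Complex.norm_natCast, div_le_iff₀ hn]
  refine h.trans (le_of_eq ?_)
  rw [one_div, inv_pow, div_inv_eq_mul]
  ring

lemma analyticAt_zero {f : ℂ → ℂ} (hf : DifferentiableOn ℂ f unitD) : AnalyticAt ℂ f 0 :=
  hf.analyticAt (isOpen_ball.mem_nhds (mem_ball_self one_pos))

lemma tc_add {f g : ℂ → ℂ} (hf : DifferentiableOn ℂ f unitD) (hg : DifferentiableOn ℂ g unitD)
    (n : ℕ) : tc (f + g) n = tc f n + tc g n := by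
  rw [tc, iteratedDeriv_add (analyticAt_zero hf).contDiffAt (analyticAt_zero hg).contDiffAt,
    add_div]
  rfl

lemma tc_sub {f g : ℂ → ℂ} (hf : DifferentiableOn ℂ f unitD) (hg : DifferentiableOn ℂ g unitD)
    (n : ℕ) : tc (f - g) n = tc f n - tc g n := by
  rw [tc, iteratedDeriv_sub (analyticAt_zero hf).contDiffAt (analyticAt_zero hg).contDiffAt,
    sub_div]
  rfl

lemma tc_smul (c : ℂ) (f : ℂ → ℂ) (n : ℕ) : tc (c • f) n = c * tc f n := by
  rw [tc, iteratedDeriv_const_smul_field, smul_eq_mul, mul_div_assoc]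
  rfl

lemma tendsto_tc {ι : Type*} {l : Filter ι} {F : ι → ℂ → ℂ} {f : ℂ → ℂ}
    (hF : ∀ i, DifferentiableOn ℂ (F i) unitD) (hf : DifferentiableOn ℂ f unitD)
    (h : TendstoUniformlyOn F f l (sphere 0 (1 / 2))) (n : ℕ) :
    Tendsto (fun i => tc (F i) n) l (𝓝 (tc f n)) := by
  rw [Metric.tendsto_nhds]
  intro ε hε
  have h2 : (0 : ℝ) < 2 ^ n := by positivity
  filter_upwards [Metric.tendstoUniformlyOn_iff.mp h (ε / 2 / 2 ^ n) (by positivity)] with i hi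
  rw [dist_eq_norm, ← tc_sub (hF i) hf]
  calc _ ≤ ε / 2 / 2 ^ n * 2 ^ n := norm_tc_le ((hF i).sub hf) (fun z hz => by
        have := hi z hz
        rw [dist_comm, dist_eq_norm] at this
        exact this.le) n
    _ < ε := by rw [div_mul_cancel₀ _ h2.ne']; linarith

lemma tendstoLocallyUniformlyOn_taylorPoly {f : ℂ → ℂ} (hf : DifferentiableOn ℂ f unitD) :
    TendstoLocallyUniformlyOn (fun N z => (taylorPoly f N).eval z) f atTop unitD := by
  intro u hu x hx
  obtain ⟨r, hxr, hr1⟩ := exists_between (mem_ball_zero_iff.mp hx)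
  have hr0 : 0 < r := (norm_nonneg _).trans_lt hxr
  lift r to NNReal using hr0.le
  have H := (hf.mono (closedBall_subset_ball hr1)).hasFPowerSeriesOnBall hr0
  rw [H.hasFPowerSeriesAt.eq_formalMultilinearSeries
    H.hasFPowerSeriesAt.analyticAt.hasFPowerSeriesAt] at H
  have hxr' : x ∈ eball (0 : ℂ) r := by
    rw [Metric.eball_coe]
    exact mem_ball_zero_iff.mpr hxr
  obtain ⟨t, ht, h⟩ := H.tendstoLocallyUniformlyOn u hu x hxr'
  rw [nhdsWithin_eq_nhds.mpr (isOpen_eball.mem_nhds hxr')] at ht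
  refine ⟨t, mem_nhdsWithin_of_mem_nhds ht, ?_⟩
  filter_upwards [(tendsto_add_atTop_nat 1).eventually h] with N hN y hy
  have h1 := hN y hy
  rw [zero_add] at h1
  convert h1 using 2
  simp [FormalMultilinearSeries.partialSum, eval_taylorPoly, tc, mul_comm]

lemma tendsto_nhds_hol {f : Hol unitD} {K : Set ℂ} (hK : IsCompact K) (hKD : K ⊆ unitD) :
    TendstoUniformlyOn (fun g : Hol unitD => g.1) f.1 (𝓝 f) K := by
  have h1 : Continuous fun f : Hol unitD =>
      UniformOnFun.ofFun {K : Set unitD | IsCompact K} fun z : unitD => f.1 z :=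
    continuous_induced_dom
  have h2 := UniformOnFun.tendsto_iff_tendstoUniformlyOn.mp (h1.tendsto f)
  have hK' : IsCompact (Subtype.val ⁻¹' K : Set unitD) :=
    (Topology.IsInducing.subtypeVal.isCompact_preimage_iff (by simpa using hKD)).mpr hK
  have h3 := h2 _ hK'
  rw [Metric.tendstoUniformlyOn_iff] at h3 ⊢
  intro ε hε
  filter_upwards [h3 ε hε] with g hg z hz
  exact hg ⟨z, hKD hz⟩ hz

lemma continuous_tc (n : ℕ) : Continuous fun g : Hol unitD => tc g.1 n :=
  continuous_iff_continuousAt.mpr fun f => tendsto_tc (fun g => g.2.1) f.2.1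
    (tendsto_nhds_hol (isCompact_sphere _ _) sphere_half_subset) n

lemma exists_tendstoLocallyUniformlyOn_unitD {F : ℕ → ℂ → ℂ}
    (hF : ∀ s, DifferentiableOn ℂ (F s) unitD) (N : ℕ)
    (h : ∀ s, N ≤ s → ∀ z ∈ closedBall (0 : ℂ) (1 - 1 / ((s : ℝ) + 2)),
      ‖F (s + 1) z - F s z‖ ≤ (1 / 2) ^ s) :
    ∃ g : ℂ → ℂ, DifferentiableOn ℂ g unitD ∧ TendstoLocallyUniformlyOn F g atTop unitD := by
  have key : ∀ r < (1 : ℝ), ∃ M, ∀ n, ∀ z ∈ closedBall (0 : ℂ) r,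
      dist (F (n + M) z) (F (n + 1 + M) z) ≤ 1 * (1 / 2) ^ n := by
    intro r hr
    obtain ⟨M, hM⟩ := exists_nat_gt (1 / (1 - r))
    refine ⟨max M N, fun n z hz => ?_⟩
    have hMn : (M : ℝ) ≤ ((n + max M N : ℕ) : ℝ) := by
      exact_mod_cast (le_max_left M N).trans (Nat.le_add_left _ _)
    have hs := h (n + max M N) ((le_max_right M N).trans (Nat.le_add_left _ _)) z
      (closedBall_subset_closedBall ?_ hz)
    · rw [dist_comm, dist_eq_norm, one_mul, show n + 1 + max M N = n + max M N + 1 by ring]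
      exact hs.trans (pow_le_pow_of_le_one (by norm_num) (by norm_num) (Nat.le_add_right _ _))
    · have h0 : 0 < 1 - r := by linarith
      have : 1 / (((n + max M N : ℕ) : ℝ) + 2) ≤ 1 - r := by
        rw [one_div_le (by positivity) h0]
        linarith
      linarith
  have hlim : ∀ z ∈ unitD, ∃ w, Tendsto (fun s => F s z) atTop (𝓝 w) := fun z hz => by
    obtain ⟨M, hM⟩ := key ‖z‖ (mem_ball_zero_iff.mp hz)
    obtain ⟨w, hw⟩ := cauchySeq_tendsto_of_complete (cauchySeq_of_le_geometric (1 / 2) 1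
      (by norm_num) (fun n => hM n z (mem_closedBall_zero_iff.mpr le_rfl)))
    exact ⟨w, (tendsto_add_atTop_iff_nat M).mp hw⟩
  choose! g hg using hlim
  have hconv : TendstoLocallyUniformlyOn F g atTop unitD := by
    intro u hu x hx
    obtain ⟨r, hxr, hr1⟩ := exists_between (mem_ball_zero_iff.mp hx)
    obtain ⟨M, hM⟩ := key r hr1
    obtain ⟨ε, hε, hu⟩ := Metric.mem_uniformity_dist.mp hu
    refine ⟨closedBall 0 r, mem_nhdsWithin_of_mem_nhds
      (closedBall_mem_nhds_of_mem (mem_ball_zero_iff.mpr hxr)), ?_⟩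
    have ht : Tendsto (fun n : ℕ => 1 * (1 / 2 : ℝ) ^ n / (1 - 1 / 2)) atTop (𝓝 0) := by
      have := ((tendsto_pow_atTop_nhds_zero_of_lt_one (r := (1 / 2 : ℝ)) (by norm_num)
        (by norm_num)).const_mul 1).div_const (1 - 1 / 2)
      simpa using this
    rw [← Filter.map_add_atTop_eq_nat M, Filter.eventually_map]
    filter_upwards [ht.eventually_lt_const hε] with n hn y hy
    refine hu ?_
    rw [dist_comm]
    exact (dist_le_of_le_geometric_of_tendsto (1 / 2) 1 (by norm_num) (fun n => hM n y hy)
      ((tendsto_add_atTop_iff_nat M).mpr (hg y (closedBall_subset_ball hr1 hy))) n).trans_lt hn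
  exact ⟨g, hconv.differentiableOn (Eventually.of_forall hF) isOpen_ball, hconv⟩

lemma exists_building_blocks {μ : ℕ → ℕ} (hμ : ∀ N : ℕ, ∃ k, N < μ k) (q : ℕ) {K : ℕ → Set ℂ}
    (hK : ∀ s, IsCompact (K s)) (hc : ∀ s, IsConnected (K s)ᶜ) (hd : ∀ s, Disjoint (K s) unitD)
    (k : ℕ → ℕ) (φ : ℕ → ℂ[X]) : ∃ (g : ℕ → ℂ → ℂ) (κ d : ℕ → ℕ),
      (∀ j, DifferentiableOn ℂ (g j) unitD) ∧ StrictMono κ ∧ StrictMono d ∧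
      (∀ s, d (s + 1) = μ (κ s) + q + 1) ∧
      (∀ j n, n < d j → tc (g j) n = 0) ∧
      (∀ i j, tc (g i) (d j) = if i = j then 1 else 0) ∧
      (∀ j s n, μ (κ s) < n → n ≤ μ (κ s) + q → tc (g j) n = 0) ∧
      ∀ s, ∀ j ≤ s, ∀ z ∈ K s,
        ‖(taylorPoly (g j) (μ (κ s))).eval z - (if j = k s then φ s else 0).eval z‖ ≤
          (1 / 2) ^ (d s + s) / (s + 1) := by
  obtain ⟨x, hx0, hx⟩ := exists_stages hμ q hK hc hd k φ
  set p : ℕ → ℕ → ℂ[X] := fun s => (x s).1 with hp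
  set d : ℕ → ℕ := fun s => (x s).2.1 with hdd
  set κ : ℕ → ℕ := fun s => (x (s + 1)).2.2 with hκ
  have hp0 : ∀ j, p 0 j = 0 := fun j => by simp [hp, hx0]
  have hdsucc : ∀ s, d (s + 1) = μ (κ s) + q + 1 := fun s => (hx s).2.1
  have hκm : StrictMono κ := strictMono_nat_of_lt_succ fun s => (hx (s + 1)).1
  have hzero : ∀ s j, s ≤ j → p s j = 0 := by
    intro s
    induction s with
    | zero => exact fun j _ => hp0 j
    | succ s ih => exact fun j hj => ((hx s).2.2.2.1 j hj).trans (ih j (by omega))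
  have hhigh : ∀ s j n, d s ≤ n + q → (p s j).coeff n = 0 := by
    rintro (_ | s) j n hn
    · rw [hp0, coeff_zero]
    · rcases le_or_gt j s with hj | hj
      · have h1 := (hx s).2.2.1 j hj
        have h2 := hdsucc s
        exact coeff_eq_zero_of_natDegree_lt (h1.trans_lt (show μ (κ s) < n by omega))
      · rw [hzero (s + 1) j hj, coeff_zero]
  have hlow : ∀ s j n, n < d s → (p (s + 1) j).coeff n = (p s j).coeff n := by
    intro s j n hn
    obtain ⟨R, hR, -⟩ := (hx s).2.2.2.2.1 j
    change p (s + 1) j = p s j + (if j = s then X ^ d s else 0) + X ^ (d s + 1) * R at hR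
    rw [hR, coeff_add, coeff_add, coeff_X_pow_mul',
      if_neg (show ¬ d s + 1 ≤ n by omega)]
    split_ifs
    · rw [coeff_X_pow, if_neg (by omega)]; ring
    · simp
  have hone : ∀ s j, (p (s + 1) j).coeff (d s) = if j = s then 1 else 0 := by
    intro s j
    obtain ⟨R, hR, -⟩ := (hx s).2.2.2.2.1 j
    change p (s + 1) j = p s j + (if j = s then X ^ d s else 0) + X ^ (d s + 1) * R at hR
    rw [hR, coeff_add, coeff_add, coeff_X_pow_mul',
      if_neg (show ¬ d s + 1 ≤ d s by omega),
      hhigh s j _ (Nat.le_add_right _ _)]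
    split_ifs
    · rw [coeff_X_pow, if_pos rfl]; ring
    · simp
  have hdm : StrictMono d := strictMono_nat_of_lt_succ fun s => by
    by_contra! hle
    have h1 := hone s s
    rw [hhigh (s + 1) s (d s) (by omega), if_pos rfl] at h1
    exact zero_ne_one h1
  have hstab : ∀ s j n, n < d s → ∀ t, s ≤ t → (p t j).coeff n = (p s j).coeff n := by
    intro s j n hn t hst
    induction t, hst using Nat.le_induction with
    | base => rfl
    | succ t hst ih => rw [hlow t j n (hn.trans_le (hdm.monotone hst)), ih]
  have hlim : ∀ j, ∃ g : ℂ → ℂ, DifferentiableOn ℂ g unitD ∧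
      TendstoLocallyUniformlyOn (fun s z => (p s j).eval z) g atTop unitD := fun j =>
    exists_tendstoLocallyUniformlyOn_unitD (fun s => (p s j).differentiable.differentiableOn)
      (j + 1) fun s hs z hz => by
        obtain ⟨R, hR, hR'⟩ := (hx s).2.2.2.2.1 j
        change p (s + 1) j = p s j + (if j = s then X ^ d s else 0) + X ^ (d s + 1) * R at hR
        rw [if_neg (by omega), add_zero] at hR
        rw [hR, eval_add, add_sub_cancel_left]
        exact hR' z hz
  choose g hgd hg using hlim
  have htc : ∀ s j n, n < d s → tc (g j) n = (p s j).coeff n := by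
    intro s j n hn
    have h1 := tendsto_tc (fun s => (p s j).differentiable.differentiableOn) (hgd j)
      ((tendstoLocallyUniformlyOn_iff_forall_isCompact isOpen_ball).mp (hg j) _
        sphere_half_subset (isCompact_sphere _ _)) n
    refine tendsto_nhds_unique h1 (tendsto_const_nhds.congr' ?_)
    filter_upwards [eventually_ge_atTop s] with t ht
    rw [tc_eval, hstab s j n hn t ht]
  have htaylor : ∀ s j, taylorPoly (g j) (μ (κ s)) = p (s + 1) j := fun s j => by
    have h2 := hdsucc s
    ext n
    rw [coeff_taylorPoly]
    split_ifs with hn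
    · exact htc (s + 1) j n (by omega)
    · rw [hhigh (s + 1) j n (by omega)]
  refine ⟨g, κ, d, hgd, hκm, hdm, hdsucc, fun j n hn => ?_, fun i j => ?_, fun j s n h1 h2 => ?_,
    fun s j hj z hz => ?_⟩
  · rw [htc j j n hn, hzero j j le_rfl, coeff_zero]
  · rw [htc (j + 1) i (d j) (hdm (Nat.lt_succ_self j)), hone]
  · have h3 := hdsucc s
    rw [htc (s + 1) j n (by omega), hhigh (s + 1) j n (by omega)]
  · rw [htaylor]
    exact (hx s).2.2.2.2.2 j hj z hz

lemma exists_dense_polynomials : ∃ φ : ℕ → ℂ[X], ∀ (p : ℂ[X]) (K : Set ℂ), IsCompact K →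
    ∀ ε > 0, ∃ i, ∀ z ∈ K, ‖p.eval z - (φ i).eval z‖ < ε := by
  obtain ⟨u, hu⟩ := TopologicalSpace.exists_dense_seq
    (Set.range fun p : ℂ[X] => (⟨fun z => p.eval z, p.continuous⟩ : C(ℂ, ℂ)))
  choose φ hφ using fun i => (u i).2
  refine ⟨φ, fun p K hK ε hε => ?_⟩
  have h1 := (ContinuousMap.tendsto_iff_forall_isCompact_tendstoUniformlyOn.mp
    (continuous_subtype_val.tendsto (⟨_, p, rfl⟩ :
      Set.range fun p : ℂ[X] => (⟨fun z => p.eval z, p.continuous⟩ : C(ℂ, ℂ))))) K hK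
  obtain ⟨i, hi⟩ := hu.mem_nhds (Metric.tendstoUniformlyOn_iff.mp h1 ε hε)
  refine ⟨i, fun z hz => ?_⟩
  have h2 := hi z hz
  rw [dist_eq_norm, ← hφ i] at h2
  exact h2

lemma exists_schedule : ∃ (C : ℕ → Set ℂ) (k : ℕ → ℕ) (φ : ℕ → ℂ[X]),
    (∀ s, IsCompact (C s)) ∧ (∀ s, IsConnected (C s)ᶜ) ∧ (∀ s, Disjoint (C s) unitD) ∧
    ∀ K, IsCompact K → IsConnected Kᶜ → Disjoint K unitD → ∀ h : ℂ → ℂ, ContinuousOn h K →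
      DifferentiableOn ℂ h (interior K) → ∀ j, ∀ ε > 0,
      ∃ᶠ s in atTop, K ⊆ C s ∧ k s = j ∧ ∀ z ∈ K, ‖h z - (φ s).eval z‖ < ε := by
  obtain ⟨C, hC1, hC2, hC3, hC⟩ := exists_exhausting_compacts
  obtain ⟨φ, hφ⟩ := exists_dense_polynomials
  obtain ⟨e, he⟩ := exists_surjective_nat (ℕ × ℕ × ℕ)
  refine ⟨fun s => C (e s.unpair.2).1, fun s => (e s.unpair.2).2.1,
    fun s => φ (e s.unpair.2).2.2, fun s => hC1 _, fun s => hC3 _, fun s => hC2 _,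
    fun K hK hc hd h hh hdiff j ε hε => frequently_atTop.mpr fun N => ?_⟩
  obtain ⟨m, hm⟩ := hC K hK hc hd
  obtain ⟨p, hp⟩ := exists_polynomial_norm_sub_lt hK hc hh hdiff (half_pos hε)
  obtain ⟨i, hi⟩ := hφ p K hK _ (half_pos hε)
  obtain ⟨t, ht⟩ := he (m, j, i)
  refine ⟨Nat.pair N t, Nat.left_le_pair N t, ?_, ?_, fun z hz => ?_⟩
  · simpa [ht] using hm
  · simp [ht]
  · simp only [Nat.unpair_pair, ht]
    calc _ = ‖(h z - p.eval z) + (p.eval z - (φ i).eval z)‖ := by rw [sub_add_sub_cancel]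
      _ ≤ ‖h z - p.eval z‖ + ‖p.eval z - (φ i).eval z‖ := norm_add_le _ _
      _ < ε := by linarith [hp z hz, hi z hz]

/-- The `n`-th Taylor coefficient of `Q * f`, as a linear functional of `f`. -/
def mulCoeff (Q : ℂ[X]) (n : ℕ) : Hol unitD →ₗ[ℂ] ℂ where
  toFun f := tc (fun z => Q.eval z * f.1 z) n
  map_add' f g := by
    refine Eq.trans (congrArg (tc · n) (funext fun z => ?_))
      (tc_add (Q.differentiable.differentiableOn.mul f.2.1)
        (Q.differentiable.differentiableOn.mul g.2.1) n)
    exact mul_add _ _ _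
  map_smul' c f := by
    refine Eq.trans (congrArg (tc · n) (funext fun z => ?_)) (tc_smul c _ n)
    exact mul_left_comm _ _ _

lemma continuous_mulCoeff (Q : ℂ[X]) (n : ℕ) : Continuous (mulCoeff Q n) := by
  have : (mulCoeff Q n : Hol unitD → ℂ) =
      fun f => ∑ i ∈ range (n + 1), Q.coeff i * tc f.1 (n - i) :=
    funext fun f => tc_eval_mul Q f.2.1 n
  rw [this]
  exact continuous_finsetSum _ fun i _ => (continuous_tc _).const_mul _

/-- The holomorphic function `g / Q` on the unit disc. -/
def divHol {g : ℂ → ℂ} (hg : DifferentiableOn ℂ g unitD) {Q : ℂ[X]}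
    (hQ : ∀ z ∈ unitD, Q.eval z ≠ 0) : Hol unitD :=
  ⟨unitD.indicator fun z => g z / Q.eval z,
    (hg.div Q.differentiable.differentiableOn hQ).congr fun _ hz => Set.indicator_of_mem hz _,
    fun _ hz => Set.indicator_of_notMem hz _⟩

lemma mulCoeff_divHol {g : ℂ → ℂ} (hg : DifferentiableOn ℂ g unitD) {Q : ℂ[X]}
    (hQ : ∀ z ∈ unitD, Q.eval z ≠ 0) (n : ℕ) : mulCoeff Q n (divHol hg hQ) = tc g n := by
  have h : (fun z => Q.eval z * (divHol hg hQ).1 z) =ᶠ[𝓝 0] g := by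
    filter_upwards [isOpen_ball.mem_nhds (mem_ball_self (x := (0 : ℂ)) one_pos)] with z hz
    have h1 : (divHol hg hQ).1 z = g z / Q.eval z :=
      Set.indicator_of_mem (show z ∈ unitD from hz) fun z => g z / Q.eval z
    rw [h1, mul_div_cancel₀ _ (hQ z hz)]
  change tc _ n = _
  rw [tc, h.iteratedDeriv_eq, tc]

lemma eq_zero_of_mulCoeff_eq_zero {Q : ℂ[X]} (hQ : ∀ z ∈ unitD, Q.eval z ≠ 0) {f : Hol unitD}
    (h : ∀ n, mulCoeff Q n f = 0) : f = 0 := by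
  ext z
  by_cases hz : z ∈ unitD
  · have h1 := (tendstoLocallyUniformlyOn_taylorPoly
      (Q.differentiable.differentiableOn.mul f.2.1)).tendsto_at hz
    have h2 : Tendsto (fun N => (taylorPoly (fun z => Q.eval z * f.1 z) N).eval z) atTop
        (𝓝 0) := by
      refine tendsto_const_nhds.congr fun N => ?_
      rw [eval_taylorPoly, Finset.sum_eq_zero fun k _ => ?_]
      rw [show tc _ k = 0 from h k, zero_mul]
    exact (mul_eq_zero.mp (tendsto_nhds_unique h1 h2)).resolve_left (hQ z hz)
  · exact f.2.2 z hz

lemma mulCoeff_eq_sum {Q : ℂ[X]} {B : ℕ → Hol unitD} {d : ℕ → ℕ} (hd : StrictMono d)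
    (h0 : ∀ j n, n < d j → mulCoeff Q n (B j) = 0)
    (h1 : ∀ i j, mulCoeff Q (d j) (B i) = if i = j then 1 else 0) {f : Hol unitD}
    (hf : f ∈ closure (Submodule.span ℂ (Set.range B) : Set (Hol unitD))) {n N : ℕ}
    (hn : n < d N) :
    mulCoeff Q n f = ∑ j ∈ range N, mulCoeff Q (d j) f * mulCoeff Q n (B j) := by
  have hclosed : IsClosed {f : Hol unitD |
      mulCoeff Q n f = ∑ j ∈ range N, mulCoeff Q (d j) f * mulCoeff Q n (B j)} :=
    isClosed_eq (continuous_mulCoeff Q n)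
      (continuous_finsetSum _ fun j _ => (continuous_mulCoeff Q _).mul_const _)
  refine closure_minimal (fun f hf => ?_) hclosed hf
  change mulCoeff Q n f = _
  induction hf using Submodule.span_induction with
  | mem x hx =>
    obtain ⟨i, rfl⟩ := hx
    simp only [h1, ite_mul, one_mul, zero_mul, Finset.sum_ite_eq, Finset.mem_range]
    split_ifs with hi
    · rfl
    · exact h0 i n (hn.trans_le (hd.monotone (not_lt.mp hi)))
  | zero => simp
  | add x y _ _ hx hy => simp only [map_add, hx, hy, add_mul, Finset.sum_add_distrib]
  | smul c x _ hx => simp only [map_smul, hx, smul_eq_mul, Finset.mul_sum, mul_assoc]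

lemma continuousOn_update_union_singleton {K : Set ℂ} (hK : IsCompact K) {a : ℂ} (ha : a ∉ K)
    {h : ℂ → ℂ} (hh : ContinuousOn h K) (c : ℂ) :
    ContinuousOn (Function.update h a c) (K ∪ {a}) := by
  refine ContinuousOn.union_of_isClosed (hh.congr fun z hz => ?_)
    (continuousOn_singleton _ _) hK.isClosed isClosed_singleton
  exact Function.update_of_ne (fun e : z = a => ha (e ▸ hz)) _ _

lemma differentiableOn_update_interior_union_singleton {K : Set ℂ} (hK : IsCompact K) {a : ℂ}
    (ha : a ∉ K) {h : ℂ → ℂ} (hh : DifferentiableOn ℂ h (interior K)) (c : ℂ) :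
    DifferentiableOn ℂ (Function.update h a c) (interior (K ∪ {a})) := by
  intro z hz
  by_cases hza : z = a
  · subst hza
    refine (differentiableWithinAt_const c).congr_of_eventuallyEq ?_ (Function.update_self _ _ _)
    filter_upwards [self_mem_nhdsWithin, mem_nhdsWithin_of_mem_nhds
      (hK.isClosed.isOpen_compl.mem_nhds ha)] with w hw hwK
    rw [(interior_subset hw).resolve_left hwK, Function.update_self]
  · have hzK : z ∈ interior K := mem_interior_iff_mem_nhds.mpr (by
      filter_upwards [mem_interior_iff_mem_nhds.mp hz, isOpen_ne.mem_nhds hza] with w hw hwa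
      exact hw.resolve_right hwa)
    refine DifferentiableAt.differentiableWithinAt ?_
    refine (hh.differentiableAt (isOpen_interior.mem_nhds hzK)).congr_of_eventuallyEq ?_
    filter_upwards [isOpen_ne.mem_nhds hza] with w hwa
    exact Function.update_of_ne hwa _ _

lemma TendstoLocallyUniformlyOn.comp_tendsto {α β ι κ : Type*} [TopologicalSpace α]
    [UniformSpace β] {F : ι → α → β} {f : α → β} {p : Filter ι} {s : Set α}
    (h : TendstoLocallyUniformlyOn F f p s) {σ : κ → ι} {l : Filter κ} (hσ : Tendsto σ l p) :
    TendstoLocallyUniformlyOn (fun k => F (σ k)) f l s := fun u hu x hx =>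
  let ⟨t, ht, h'⟩ := h u hu x hx
  ⟨t, ht, hσ.eventually h'⟩

/-- A universality criterion in terms of the Taylor polynomials of `Q * f`. -/
lemma mem_UQset_of_frequently {μ κ : ℕ → ℕ} (hκ : StrictMono κ)
    (hμκ : Tendsto (fun s => μ (κ s)) atTop atTop) {a : ℂ} (ha : 1 ≤ ‖a‖) {q : ℕ} (hq : 1 ≤ q)
    {f : Hol unitD}
    (hgap : ∀ s n, μ (κ s) < n → n ≤ μ (κ s) + q → mulCoeff ((1 - C a⁻¹ * X) ^ q) n f = 0)
    (happ : ∀ K, IsCompact K → IsConnected Kᶜ → Disjoint K unitD → ∀ h : ℂ → ℂ,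
      ContinuousOn h K → DifferentiableOn ℂ h (interior K) → ∀ ε > 0, ∃ᶠ s in atTop, ∀ z ∈ K,
        ‖(taylorPoly (fun z => ((1 - C a⁻¹ * X : ℂ[X]) ^ q).eval z * f.1 z) (μ (κ s))).eval z
          - h z‖ < ε) :
    f ∈ UQset μ q ((1 - C a⁻¹ * X) ^ q) {z : ℂ | ((1 - C a⁻¹ * X : ℂ[X]) ^ q).eval z = 0} := by
  set Q : ℂ[X] := (1 - C a⁻¹ * X) ^ q with hQdef
  have ha0 : a ≠ 0 := norm_pos_iff.mp (zero_lt_one.trans_le ha)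
  have hQ : ∀ z, Q.eval z = 0 ↔ z = a := fun z => by
    rw [hQdef, eval_pow, pow_eq_zero_iff (by omega), one_sub_C_inv_mul_X ha0, eval_mul, eval_C,
      mul_eq_zero, neg_eq_zero, inv_eq_zero, eval_sub, eval_X, eval_C, sub_eq_zero]
    simp [ha0]
  have haD : a ∉ unitD := fun h => (mem_ball_zero_iff.mp h).not_ge ha
  have hQD : ∀ z ∈ unitD, Q.eval z ≠ 0 := fun z hz h => haD ((hQ z).mp h ▸ hz)
  intro K hK hdisj hc h hh hdiff
  obtain ⟨hdD, hdE⟩ := Set.disjoint_union_right.mp hdisj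
  have haK : a ∉ K := fun h => Set.disjoint_left.mp hdE h ((hQ a).mpr rfl)
  have hQK : ∀ z ∈ K, Q.eval z ≠ 0 := fun z hz h => haK ((hQ z).mp h ▸ hz)
  set F : ℂ → ℂ := fun z => Q.eval z * f.1 z with hF
  set H : ℂ → ℂ := Function.update (fun z => h z * Q.eval z) a 1 with hH
  obtain ⟨σ, hσ, hT⟩ := extraction_forall_of_frequently fun n : ℕ =>
    happ (K ∪ {a}) (hK.union isCompact_singleton) (isConnected_compl_union_singleton hK hc haK)
      (Set.disjoint_union_left.mpr ⟨hdD, Set.disjoint_singleton_left.mpr haD⟩) H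
      (continuousOn_update_union_singleton hK haK (hh.mul Q.continuous.continuousOn) 1)
      (differentiableOn_update_interior_union_singleton hK haK
        (hdiff.mul Q.differentiable.differentiableOn) 1)
      (1 / ((n : ℝ) + 1)) Nat.one_div_pos_of_nat
  refine ⟨κ ∘ σ, hκ.comp hσ, fun n => taylorPoly F (μ (κ (σ n))), fun n => ?_, ?_, ?_⟩
  · refine mem_Nset_and_isPade f.2.1 ha0 hF (fun j h1 h2 => hgap _ j h1 h2) fun h0 => ?_
    have h1 := hT n a (Or.inr rfl)
    change (taylorPoly F (μ (κ (σ n)))).eval a = 0 at h0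
    rw [h0, hH, Function.update_self, zero_sub, norm_neg, norm_one, lt_div_iff₀ (by positivity)]
      at h1
    linarith [(Nat.cast_nonneg n : (0 : ℝ) ≤ n)]
  · obtain ⟨M, hM⟩ := hK.exists_bound_of_continuousOn
      (Q.continuous.continuousOn.inv₀ hQK)
    rw [Metric.tendstoUniformlyOn_iff]
    intro ε hε
    have hM' : 0 < max M 1 := lt_max_of_lt_right one_pos
    filter_upwards [tendsto_one_div_add_atTop_nhds_zero_nat.eventually_lt_const
      (div_pos hε hM')] with n hn z hz
    have h1 := (hT n z (Or.inl hz)).trans hn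
    rw [hH, Function.update_of_ne (fun e : z = a => haK (e ▸ hz))] at h1
    rw [dist_comm, dist_eq_norm, show (taylorPoly F (μ (κ (σ n)))).eval z / Q.eval z - h z =
      ((taylorPoly F (μ (κ (σ n)))).eval z - h z * Q.eval z) * (Q.eval z)⁻¹ by
        field_simp [hQK z hz], norm_mul]
    calc _ ≤ ‖(taylorPoly F (μ (κ (σ n)))).eval z - h z * Q.eval z‖ * max M 1 := by
          gcongr
          exact (hM z hz).trans (le_max_left _ _)
      _ < ε / max M 1 * max M 1 := by gcongr
      _ = ε := div_mul_cancel₀ _ hM'.ne'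
  · have h1 := (tendstoLocallyUniformlyOn_taylorPoly
      (Q.differentiable.differentiableOn.mul f.2.1)).comp_tendsto
        (hμκ.comp hσ.tendsto_atTop)
    have h2 : TendstoLocallyUniformlyOn (fun (_ : ℕ) z => Q.eval z) (fun z => Q.eval z) atTop
        unitD := fun u hu x _ => ⟨Set.univ, univ_mem,
          Eventually.of_forall fun _ _ _ => refl_mem_uniformity hu⟩
    refine (h1.div₀ h2 ?_ Q.continuous.continuousOn hQD).congr_right fun z hz => ?_
    · exact Q.continuous.continuousOn.mul f.2.1.continuousOn
    · exact mul_div_cancel_left₀ _ (hQD z hz)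

lemma exists_norm_mulCoeff_le (Q : ℂ[X]) (f : Hol unitD) :
    ∃ M : ℝ, 0 ≤ M ∧ ∀ n, ‖mulCoeff Q n f‖ ≤ M * 2 ^ n := by
  have hd : DifferentiableOn ℂ (fun z => Q.eval z * f.1 z) unitD :=
    Q.differentiable.differentiableOn.mul f.2.1
  obtain ⟨M, hM⟩ := (isCompact_sphere (0 : ℂ) (1 / 2)).exists_bound_of_continuousOn
    (hd.continuousOn.mono sphere_half_subset)
  exact ⟨max M 0, le_max_right _ _,
    norm_tc_le hd fun z hz => (hM z hz).trans (le_max_left _ _)⟩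

lemma linearIndependent_of_mulCoeff {Q : ℂ[X]} {B : ℕ → Hol unitD} {d : ℕ → ℕ}
    (h : ∀ i j, mulCoeff Q (d j) (B i) = if i = j then 1 else 0) : LinearIndependent ℂ B := by
  rw [linearIndependent_iff']
  intro s c hc i hi
  have h1 := congrArg (mulCoeff Q (d i)) hc
  simpa [h, hi] using h1

/-- Theorem 4.9 (spaceability) : for an unbounded sequence `μ` of positive integers,
`a ∉ 𝔻` and `q ≥ 1`, there is a linearly independent sequence `(f_k)` in
`𝒰_{Q_q}^μ(𝔻)` such that `F = clos(span(f_k, k ≥ 0))` is a closed infinite-dimensional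
subspace of `H(𝔻)` with `F ∖ {0} ⊆ 𝒰̃_{Q_q}^μ(𝔻)`. -/
theorem stmt_15 (μ : ℕ → ℕ) (hμpos : ∀ k, 0 < μ k) (hμub : ∀ N : ℕ, ∃ k, N < μ k)
    (a : ℂ) (ha : 1 ≤ ‖a‖) (q : ℕ) (hq : 1 ≤ q) :
    ∃ f : ℕ → Hol unitD,
      (∀ k, f k ∈ UQset μ q ((1 - Polynomial.C a⁻¹ * Polynomial.X) ^ q)
        {z : ℂ | ((1 - Polynomial.C a⁻¹ * Polynomial.X) ^ q).eval z = 0}) ∧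
      LinearIndependent ℂ f ∧
      IsClosed (closure (↑(Submodule.span ℂ (Set.range f)) : Set (Hol unitD))) ∧
      ∀ g ∈ closure (↑(Submodule.span ℂ (Set.range f)) : Set (Hol unitD)),
        g ≠ 0 → g ∈ Utilde μ a q := by
  set Q : ℂ[X] := (1 - C a⁻¹ * X) ^ q with hQdef
  have ha0 : a ≠ 0 := norm_pos_iff.mp (zero_lt_one.trans_le ha)
  have hQD : ∀ z ∈ unitD, Q.eval z ≠ 0 := fun z hz h => by
    rw [hQdef, eval_pow, pow_eq_zero_iff (by omega), one_sub_C_inv_mul_X ha0, eval_mul, eval_C,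
      mul_eq_zero, neg_eq_zero, inv_eq_zero, eval_sub, eval_X, eval_C, sub_eq_zero] at h
    exact (mem_ball_zero_iff.mp hz).not_ge (h.resolve_left ha0 ▸ ha)
  obtain ⟨K, k, φ, hK, hKc, hKd, hsched⟩ := exists_schedule
  obtain ⟨g, κ, d, hg, hκ, hd, hdsucc, hlow, hdelta, hgap, happ⟩ :=
    exists_building_blocks hμub q hK hKc hKd k φ
  set B : ℕ → Hol unitD := fun j => divHol (hg j) hQD with hB
  have hBtc : ∀ j n, mulCoeff Q n (B j) = tc (g j) n := fun j n => mulCoeff_divHol _ _ _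
  have hBdelta : ∀ i j, mulCoeff Q (d j) (B i) = if i = j then 1 else 0 := fun i j => by
    rw [hBtc, hdelta]
  have hli : LinearIndependent ℂ B := linearIndependent_of_mulCoeff hBdelta
  have hμκ : Tendsto (fun s => μ (κ s)) atTop atTop := by
    refine tendsto_atTop_mono (fun s => ?_) (tendsto_sub_atTop_nat q)
    have h1 := hd.id_le (s + 1)
    have h2 := hdsucc s
    simp only [id] at h1
    omega
  have huniv : ∀ f ∈ closure (Submodule.span ℂ (Set.range B) : Set (Hol unitD)), f ≠ 0 →
      f ∈ UQset μ q Q {z : ℂ | Q.eval z = 0} := by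
    intro f hf hf0
    have hsum : ∀ n N, n < d N →
        mulCoeff Q n f = ∑ j ∈ range N, mulCoeff Q (d j) f * tc (g j) n := fun n N hn => by
      simp only [← hBtc]
      exact mulCoeff_eq_sum hd (fun j n hn => by rw [hBtc, hlow j n hn]) hBdelta hf hn
    obtain ⟨i, hi⟩ : ∃ i, mulCoeff Q (d i) f ≠ 0 := by
      by_contra! h
      refine hf0 (eq_zero_of_mulCoeff_eq_zero hQD fun n => ?_)
      rw [hsum n (n + 1) (Nat.lt_of_succ_le (hd.id_le (n + 1)))]
      exact Finset.sum_eq_zero fun j _ => by rw [h, zero_mul]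
    set α : ℂ := mulCoeff Q (d i) f with hα
    have hα0 : 0 < ‖α‖ := norm_pos_iff.mpr hi
    obtain ⟨M, hM0, hM⟩ := exists_norm_mulCoeff_le Q f
    refine mem_UQset_of_frequently hκ hμκ ha hq (fun s n h1 h2 => ?_)
      fun L hL hLc hLd h hh hdiff ε hε => ?_
    · have h3 := hdsucc s
      rw [← hQdef, hsum n (s + 1) (by omega)]
      exact Finset.sum_eq_zero fun j _ => by rw [hgap j s n h1 h2, mul_zero]
    · have hfreq := hsched L hL hLc hLd (fun z => h z / α) (hh.div_const α)
        (hdiff.div_const α) i (ε / 2 / ‖α‖) (by positivity)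
      have hsmall : ∀ᶠ s : ℕ in atTop, M * (1 / 2) ^ s < ε / 2 := by
        have h1 := (tendsto_pow_atTop_nhds_zero_of_lt_one (r := (1 / 2 : ℝ)) (by norm_num)
          (by norm_num)).const_mul M
        rw [mul_zero] at h1
        exact h1.eventually_lt_const (half_pos hε)
      refine (hfreq.and_eventually (hsmall.and (eventually_ge_atTop i))).mono ?_
      rintro s ⟨⟨hLs, hks, hφ⟩, hs, his⟩ z hz
      have hT : (taylorPoly (fun z => Q.eval z * f.1 z) (μ (κ s))).eval z =
          ∑ j ∈ range (s + 1), mulCoeff Q (d j) f * (taylorPoly (g j) (μ (κ s))).eval z := by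
        simp only [eval_taylorPoly, Finset.mul_sum]
        rw [Finset.sum_comm]
        refine Finset.sum_congr rfl fun n hn => ?_
        have h3 := hdsucc s
        rw [Finset.mem_range] at hn
        rw [show tc (fun z => Q.eval z * f.1 z) n = _ from hsum n (s + 1) (by omega),
          Finset.sum_mul]
        exact Finset.sum_congr rfl fun j _ => mul_assoc _ _ _
      have hφi : α * (φ s).eval z =
          ∑ j ∈ range (s + 1), mulCoeff Q (d j) f * (if j = k s then φ s else 0).eval z := by
        rw [Finset.sum_eq_single_of_mem i (Finset.mem_range.mpr (Nat.lt_succ_of_le his))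
          fun j _ hj => by rw [hks, if_neg hj, eval_zero, mul_zero], hks, if_pos rfl]
      have h1 : ‖(taylorPoly (fun z => Q.eval z * f.1 z) (μ (κ s))).eval z
          - α * (φ s).eval z‖ ≤ M * (1 / 2) ^ s := by
        rw [hT, hφi, ← Finset.sum_sub_distrib]
        calc _ ≤ ∑ j ∈ range (s + 1), M * (1 / 2) ^ s / (s + 1) := by
              refine norm_sum_le_of_le _ fun j hj => ?_
              have hjs : j ≤ s := Nat.lt_succ_iff.mp (Finset.mem_range.mp hj)
              rw [← mul_sub, norm_mul]
              calc _ ≤ (M * 2 ^ d s) * ((1 / 2) ^ (d s + s) / (s + 1)) := by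
                    refine mul_le_mul ((hM _).trans ?_) (happ s j hjs z (hLs hz))
                      (norm_nonneg _) (by positivity)
                    gcongr
                    · norm_num
                    · exact hd.monotone hjs
                _ = M * (1 / 2) ^ s / (s + 1) := by
                    rw [pow_add, one_div, inv_pow 2 (d s)]
                    field_simp
          _ = M * (1 / 2) ^ s := by
              rw [Finset.sum_const, Finset.card_range, nsmul_eq_mul]
              push_cast
              field_simp
      have h2 : ‖α * (φ s).eval z - h z‖ < ε / 2 := by
        rw [show α * (φ s).eval z - h z = -(α * (h z / α - (φ s).eval z)) by
          rw [mul_sub, mul_div_cancel₀ _ hi]; ring, norm_neg, norm_mul, mul_comm]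
        exact (lt_div_iff₀ hα0).mp (hφ z hz)
      calc _ = ‖((taylorPoly (fun z => Q.eval z * f.1 z) (μ (κ s))).eval z
            - α * (φ s).eval z) + (α * (φ s).eval z - h z)‖ := by rw [sub_add_sub_cancel]
        _ < ε := (norm_add_le _ _).trans_lt (by linarith)
  exact ⟨B, fun j => huniv _ (subset_closure (Submodule.subset_span ⟨j, rfl⟩)) (hli.ne_zero j),
    hli, isClosed_closure, fun f hf hf0 => Set.mem_biUnion (Set.mem_Iic.mpr le_rfl)
      (huniv f hf hf0)⟩

end
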